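/- Let n ≥ 3 be an integer, N = 2n/(n−2), α ∈ (0,1) and β ∈ (0, n−2). Let τ and w be locally C^{0,α} functions on ℝⁿ satisfying |τ(x)| ≤ C(1+|x|)^{−1−β/2} and |w(x)| ≤ C(1+|x|)^{−1−β/2}. Then the Lichnerowicz equation −(4(n−1)/(n−2)) Δu + ((n−1)/n) τ² u^{N−1} = w² u^{−N−1} on ℝⁿ admits a positive C² solution u with |u(x) − 1| ≤ C'(1+|x|)^{−β} for some constant C' > 0, and this solution is unique among positive C² solutions u with u − 1 = O(|x|^{−β}) at infinity. -/

import Mathlib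

open scoped BigOperators
open Real Filter MeasureTheory

noncomputable section

/-- Partial derivative `∂ᵢ f (x)` on Euclidean space. -/
def pd {n : ℕ} (f : EuclideanSpace ℝ (Fin n) → ℝ) (i : Fin n)
    (x : EuclideanSpace ℝ (Fin n)) : ℝ :=
  fderiv ℝ f x (EuclideanSpace.single i 1)

/-- Euclidean Laplacian `Δ f (x) = ∑ i, ∂ᵢ∂ᵢ f (x)`. -/
def lap {n : ℕ} (f : EuclideanSpace ℝ (Fin n) → ℝ)
    (x : EuclideanSpace ℝ (Fin n)) : ℝ :=
  ∑ i, pd (pd f i) i x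

/-- Conformal Killing operator
`(LW)_{ij} = ∂ᵢ W_j + ∂_j W_i − (2 δ_{ij}/n) ∑ₖ ∂ₖ Wₖ`. -/
def cK {n : ℕ} (W : Fin n → EuclideanSpace ℝ (Fin n) → ℝ) (i j : Fin n)
    (x : EuclideanSpace ℝ (Fin n)) : ℝ :=
  pd (W j) i x + pd (W i) j x
    - (2 / (n : ℝ)) * (if i = j then (1 : ℝ) else 0) * ∑ k, pd (W k) k x

/-- The critical exponent `N = 2n/(n−2)`. -/
def Nc (n : ℕ) : ℝ := 2 * n / ((n : ℝ) - 2)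

/-- The vacuum Einstein conformal constraint equations on `ℝⁿ` (flat background,
`σ ≡ 0`): the Lichnerowicz equation together with the vector equations. -/
def SolvesCCE (n : ℕ) (φ τ : EuclideanSpace ℝ (Fin n) → ℝ)
    (W : Fin n → EuclideanSpace ℝ (Fin n) → ℝ) : Prop :=
  (∀ x, -(4 * ((n : ℝ) - 1) / ((n : ℝ) - 2)) * lap φ x
      + (((n : ℝ) - 1) / (n : ℝ)) * (τ x) ^ 2 * (φ x) ^ (Nc n - 1)
      = (∑ i, ∑ j, (cK W i j x) ^ 2) * (φ x) ^ (-(Nc n) - 1)) ∧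
  (∀ i, ∀ x, lap (W i) x
      + (((n : ℝ) - 2) / (n : ℝ)) * pd (fun y => ∑ j, pd (W j) j y) i x
      = (((n : ℝ) - 1) / (n : ℝ)) * (φ x) ^ (Nc n) * pd τ i x)

/-- The second fundamental form `k_{ij} = (τ/n) φ^{N−2} δ_{ij} + φ^{−2} (LW)_{ij}`
produced by the conformal method. -/
def kTen (n : ℕ) (φ τ : EuclideanSpace ℝ (Fin n) → ℝ)
    (W : Fin n → EuclideanSpace ℝ (Fin n) → ℝ) (i j : Fin n)
    (x : EuclideanSpace ℝ (Fin n)) : ℝ :=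
  (τ x / (n : ℝ)) * (φ x) ^ (Nc n - 2) * (if i = j then (1 : ℝ) else 0)
    + (φ x) ^ (-2 : ℝ) * cK W i j x

theorem lap_eq_of_hasFDerivAt {n : ℕ} {u : EuclideanSpace ℝ (Fin n) → ℝ}
    {D : EuclideanSpace ℝ (Fin n) → EuclideanSpace ℝ (Fin n) →L[ℝ] ℝ}
    {D₂ : EuclideanSpace ℝ (Fin n) →L[ℝ] EuclideanSpace ℝ (Fin n) →L[ℝ] ℝ}
    {x : EuclideanSpace ℝ (Fin n)} (h : ∀ y, HasFDerivAt u (D y) y) (h₂ : HasFDerivAt D D₂ x) :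
    lap u x = ∑ i, D₂ (EuclideanSpace.single i 1) (EuclideanSpace.single i 1) := by
  refine Finset.sum_congr rfl fun i _ => ?_
  have h1 : pd u i = fun y => D y (EuclideanSpace.single i 1) := by
    funext y; simp [pd, (h y).fderiv]
  rw [h1, pd]
  have := h₂.clm_apply (hasFDerivAt_const (EuclideanSpace.single i (1 : ℝ)) x)
  rw [this.fderiv]
  simp

theorem ContDiff.hasFDerivAt_fderiv_two {E : Type*} [NormedAddCommGroup E] [NormedSpace ℝ E]
    {u : E → ℝ} (hu : ContDiff ℝ 2 u) :
    (∀ x, HasFDerivAt u (fderiv ℝ u x) x) ∧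
      ∀ x, HasFDerivAt (fderiv ℝ u) (fderiv ℝ (fderiv ℝ u) x) x := by
  refine ⟨fun x => (hu.differentiable (by norm_num) x).hasFDerivAt, fun x => ?_⟩
  have : ContDiff ℝ 1 (fderiv ℝ u) := hu.fderiv_right (by norm_num)
  exact (this.differentiable (by norm_num) x).hasFDerivAt

theorem lap_sub_const_mul {n : ℕ} {u v : EuclideanSpace ℝ (Fin n) → ℝ} (hu : ContDiff ℝ 2 u)
    (hv : ContDiff ℝ 2 v) (c : ℝ) (x : EuclideanSpace ℝ (Fin n)) :
    lap (fun y => u y - c * v y) x = lap u x - c * lap v x := by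
  obtain ⟨hu1, hu2⟩ := hu.hasFDerivAt_fderiv_two
  obtain ⟨hv1, hv2⟩ := hv.hasFDerivAt_fderiv_two
  have h : lap (fun y => u y - c * v y) x = _ :=
    lap_eq_of_hasFDerivAt (fun y => (hu1 y).sub ((hv1 y).const_mul c))
      ((hu2 x).sub ((hv2 x).const_smul c))
  rw [h, lap_eq_of_hasFDerivAt hu1 (hu2 x), lap_eq_of_hasFDerivAt hv1 (hv2 x)]
  simp [Finset.sum_sub_distrib, Finset.mul_sum]

theorem lap_nonpos_of_isLocalMax {n : ℕ} {q : EuclideanSpace ℝ (Fin n) → ℝ}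
    (hq : ContDiff ℝ 2 q) {x : EuclideanSpace ℝ (Fin n)} (hx : IsLocalMax q x) : lap q x ≤ 0 := by
  obtain ⟨h1, h2⟩ := hq.hasFDerivAt_fderiv_two
  rw [lap_eq_of_hasFDerivAt h1 (h2 x)]
  refine Finset.sum_nonpos fun i _ => ?_
  set e : EuclideanSpace ℝ (Fin n) := EuclideanSpace.single i 1
  by_contra! hpos
  have hline : ∀ t : ℝ, HasDerivAt (fun t : ℝ => x + t • e) e t := fun t => by
    simpa using ((hasDerivAt_id t).smul_const e).const_add x
  have hφ : ∀ t : ℝ, HasDerivAt (fun t : ℝ => q (x + t • e)) (fderiv ℝ q (x + t • e) e) t :=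
    fun t => (h1 _).comp_hasDerivAt t (hline t)
  have hφ' : deriv (fun t : ℝ => q (x + t • e)) = fun t => fderiv ℝ q (x + t • e) e :=
    funext fun t => (hφ t).deriv
  have hφ2 : HasDerivAt (fun t : ℝ => fderiv ℝ q (x + t • e) e)
      (fderiv ℝ (fderiv ℝ q) x e e) 0 := by
    have h3 : HasDerivAt (fun t : ℝ => fderiv ℝ q (x + t • e)) (fderiv ℝ (fderiv ℝ q) x e) 0 := by
      have h4 := h2 (x + (0 : ℝ) • e)
      have h5 := h4.comp_hasDerivAt (0 : ℝ) (hline 0)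
      rw [zero_smul, add_zero] at h5
      exact h5
    simpa using h3.clm_apply (hasDerivAt_const (0 : ℝ) e)
  have hcont : ContinuousAt (fun t : ℝ => x + t • e) 0 := (hline 0).continuousAt
  have hmax : IsLocalMax (fun t : ℝ => q (x + t • e)) 0 := by
    have : Tendsto (fun t : ℝ => x + t • e) (nhds 0) (nhds x) := by
      simpa [ContinuousAt] using hcont
    filter_upwards [this.eventually hx] with t ht
    simpa using ht
  have hmin : IsLocalMin (fun t : ℝ => q (x + t • e)) 0 := by
    refine isLocalMin_of_deriv_deriv_pos ?_ hmax.deriv_eq_zero (hφ 0).continuousAt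
    rw [hφ', hφ2.deriv]
    exact hpos
  have hconst : (fun t : ℝ => q (x + t • e)) =ᶠ[nhds 0] fun _ => q (x + (0 : ℝ) • e) := by
    filter_upwards [hmax, hmin] with t h h' using le_antisymm h h'
  have h0 := hconst.deriv.deriv_eq
  rw [hφ', hφ2.deriv] at h0
  simp at h0
  exact hpos.ne' h0

theorem nonpos_of_lap_pos {n : ℕ} {q : EuclideanSpace ℝ (Fin n) → ℝ} (hq : ContDiff ℝ 2 q)
    (hinf : ∀ ε > 0, ∀ᶠ x in cocompact (EuclideanSpace ℝ (Fin n)), q x ≤ ε)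
    (hlap : ∀ x, 0 < q x → 0 < lap q x) (x : EuclideanSpace ℝ (Fin n)) : q x ≤ 0 := by
  by_contra! hx
  obtain ⟨y, hy⟩ := hq.continuous.exists_forall_ge' x (hinf _ hx)
  have h1 : lap q y ≤ 0 := lap_nonpos_of_isLocalMax hq (Filter.Eventually.of_forall hy)
  exact absurd (hlap y (hx.trans_le (hy x))) (not_lt.2 h1)

theorem hasFDerivAt_comp_norm_sq {E : Type*} [NormedAddCommGroup E] [InnerProductSpace ℝ E]
    {q : ℝ → ℝ} {q' : ℝ} {x : E} (h : HasDerivAt q q' (‖x‖ ^ 2)) :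
    HasFDerivAt (fun y : E => q (‖y‖ ^ 2)) ((2 * q') • innerSL ℝ x) x := by
  have := h.comp_hasFDerivAt x (hasStrictFDerivAt_norm_sq x).hasFDerivAt
  refine this.congr_fderiv ?_
  ext v; simp; ring

theorem lap_comp_norm_sq {n : ℕ} {q q' q'' : ℝ → ℝ} (h : ∀ r, 0 ≤ r → HasDerivAt q (q' r) r)
    (h' : ∀ r, 0 ≤ r → HasDerivAt q' (q'' r) r) (x : EuclideanSpace ℝ (Fin n)) :
    lap (fun y => q (‖y‖ ^ 2)) x = 4 * ‖x‖ ^ 2 * q'' (‖x‖ ^ 2) + 2 * n * q' (‖x‖ ^ 2) := by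
  have h1 : ∀ y : EuclideanSpace ℝ (Fin n), HasFDerivAt (fun y => q (‖y‖ ^ 2))
      ((2 * q' (‖y‖ ^ 2)) • innerSL ℝ y) y := fun y =>
    hasFDerivAt_comp_norm_sq (h _ (by positivity))
  have h2 := ((hasFDerivAt_comp_norm_sq (h' (‖x‖ ^ 2) (by positivity))).const_mul 2).smul
    (innerSL ℝ (E := EuclideanSpace ℝ (Fin n))).hasFDerivAt
  rw [lap_eq_of_hasFDerivAt h1 h2]
  have h6 : ‖x‖ ^ 2 = ∑ i, x i ^ 2 := by simp [EuclideanSpace.norm_sq_eq]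
  trans ∑ i, (4 * q'' (‖x‖ ^ 2) * x i ^ 2 + 2 * q' (‖x‖ ^ 2))
  · refine Finset.sum_congr rfl fun i _ => ?_
    have h4 : inner ℝ x (EuclideanSpace.single i (1 : ℝ)) = x i := by
      simp [EuclideanSpace.inner_single_right]
    have h5 : inner ℝ (EuclideanSpace.single i (1 : ℝ)) (EuclideanSpace.single i (1 : ℝ)) =
      (1 : ℝ) := by simp
    change 2 * q' (‖x‖ ^ 2) *
      inner ℝ (EuclideanSpace.single i (1 : ℝ)) (EuclideanSpace.single i (1 : ℝ)) +
      (2 * (2 * q'' (‖x‖ ^ 2) * inner ℝ x (EuclideanSpace.single i (1 : ℝ)))) *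
        inner ℝ x (EuclideanSpace.single i (1 : ℝ)) = _
    rw [h4, h5]
    ring
  · rw [Finset.sum_add_distrib, ← Finset.mul_sum, ← h6]
    simp
    ring

section Gaussian

set_option maxSynthPendingDepth 3

variable {E F : Type*} [NormedAddCommGroup E] [InnerProductSpace ℝ E] [FiniteDimensional ℝ E]
  [MeasurableSpace E] [BorelSpace E] [NormedAddCommGroup F] [NormedSpace ℝ F]

theorem integrable_exp_neg_mul_norm_sq {c : ℝ} (hc : 0 < c) :
    Integrable (fun z : E => exp (-c * ‖z‖ ^ 2)) := by
  have h := (GaussianFourier.integrable_cexp_neg_mul_sq_norm_add (V := E) (b := (c : ℂ))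
    (by simpa using hc) 0 0).norm
  refine h.congr (Eventually.of_forall fun z => ?_)
  simp [Complex.norm_exp, ← Complex.ofReal_pow]

theorem norm_sq_mul_exp_le {c : ℝ} (hc : 0 < c) (r : ℝ) :
    r ^ 2 * exp (-c * r ^ 2) ≤ 2 / c * exp (-(c / 2) * r ^ 2) := by
  have h1 : c / 2 * r ^ 2 ≤ exp (c / 2 * r ^ 2) := by
    linarith [add_one_le_exp (c / 2 * r ^ 2)]
  have h2 : exp (-c * r ^ 2) = exp (-(c / 2) * r ^ 2) * exp (-(c / 2) * r ^ 2) := by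
    rw [← exp_add]; ring_nf
  have h3 : exp (c / 2 * r ^ 2) * exp (-(c / 2) * r ^ 2) = 1 := by
    rw [← exp_add]; ring_nf; simp
  have h4 : c / 2 * r ^ 2 * exp (-(c / 2) * r ^ 2) ≤ 1 :=
    (mul_le_mul_of_nonneg_right h1 (exp_pos _).le).trans h3.le
  rw [h2]
  have h5 := mul_le_mul_of_nonneg_left h4 (show 0 ≤ 2 / c * exp (-(c / 2) * r ^ 2) by positivity)
  calc _ = 2 / c * exp (-(c / 2) * r ^ 2) * (c / 2 * r ^ 2 * exp (-(c / 2) * r ^ 2)) := by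
        field_simp
    _ ≤ _ := by simpa using h5

/-- A continuous kernel dominated by a Gaussian. -/
structure GaussianBounded (κ : E → F) : Prop where
  continuous : Continuous κ
  bound : ∃ A, 0 ≤ A ∧ ∀ z, ‖κ z‖ ≤ A * exp (-(1 / 4) * ‖z‖ ^ 2)

theorem GaussianBounded.integrable_norm_sq_mul {G : Type*} [NormedAddCommGroup G] {κ : E → G}
    (hκ : GaussianBounded κ) :
    Integrable (fun z => ‖z‖ ^ 2 * ‖κ z‖) := by
  obtain ⟨A, hA, h⟩ := hκ.bound
  refine ((integrable_exp_neg_mul_norm_sq (E := E) (c := 1 / 4 / 2) (by norm_num)).const_mul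
    (A * (2 / (1 / 4)))).mono' ?_ (Eventually.of_forall fun z => ?_)
  · have := hκ.continuous
    exact (by fun_prop : Continuous fun z => ‖z‖ ^ 2 * ‖κ z‖).aestronglyMeasurable
  · rw [norm_of_nonneg (by positivity)]
    calc ‖z‖ ^ 2 * ‖κ z‖ ≤ ‖z‖ ^ 2 * (A * exp (-(1 / 4) * ‖z‖ ^ 2)) := by gcongr; exact h z
      _ = A * (‖z‖ ^ 2 * exp (-(1 / 4) * ‖z‖ ^ 2)) := by ring
      _ ≤ A * (2 / (1 / 4) * exp (-(1 / 4 / 2) * ‖z‖ ^ 2)) :=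
          mul_le_mul_of_nonneg_left (norm_sq_mul_exp_le (by norm_num) _) hA
      _ = _ := by ring

theorem GaussianBounded.integrable {G : Type*} [NormedAddCommGroup G] {κ : E → G}
    (hκ : GaussianBounded κ) : Integrable κ := by
  obtain ⟨A, hA, h⟩ := hκ.bound
  exact ((integrable_exp_neg_mul_norm_sq (c := 1 / 4) (by norm_num)).const_mul A).mono'
    hκ.continuous.aestronglyMeasurable (Eventually.of_forall h)

/-- The average of the dilates of `f` about `x` against the kernel `κ`. -/
def kernelAvg (κ : E → F) (f : E → ℝ) (s : ℝ) (x : E) : F :=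
  ∫ z, f (x + s • z) • κ z

theorem kernelAvg_integrable {κ : E → F} (hκ : Integrable κ) {f : E → ℝ} (hf : Continuous f)
    {M : ℝ} (hM : ∀ x, |f x| ≤ M) (s : ℝ) (x : E) :
    Integrable (fun z => f (x + s • z) • κ z) :=
  hκ.bdd_smul M (by fun_prop : Continuous fun z => f (x + s • z)).aestronglyMeasurable
    (Eventually.of_forall fun z => hM _)

theorem continuous_kernelAvg {κ : E → F} (hκ : Integrable κ) {f : E → ℝ} (hf : Continuous f)
    {M : ℝ} (hM : ∀ x, |f x| ≤ M) :
    Continuous (fun p : ℝ × E => kernelAvg κ f p.1 p.2) := by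
  refine continuous_of_dominated (bound := fun z => M * ‖κ z‖)
    (fun p => (kernelAvg_integrable hκ hf hM p.1 p.2).aestronglyMeasurable)
    (fun p => Eventually.of_forall fun z => ?_) (hκ.norm.const_mul M)
    (Eventually.of_forall fun z => by fun_prop)
  rw [norm_smul]
  exact mul_le_mul_of_nonneg_right (hM _) (norm_nonneg _)

theorem norm_kernelAvg_le {κ : E → F} (hκ : Integrable κ) {f : E → ℝ}
    {M : ℝ} (hM : ∀ x, |f x| ≤ M) (s : ℝ) (x : E) :
    ‖kernelAvg κ f s x‖ ≤ M * ∫ z, ‖κ z‖ := by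
  rw [← integral_const_mul]
  refine norm_integral_le_of_norm_le (hκ.norm.const_mul M) (Eventually.of_forall fun z => ?_)
  rw [norm_smul]
  exact mul_le_mul_of_nonneg_right (hM _) (norm_nonneg _)

theorem kernelAvg_one_eq (κ : E → F) (f : E → ℝ) (x : E) :
    kernelAvg κ f 1 x = ∫ y, f y • κ (y - x) := by
  rw [← integral_add_left_eq_self _ x]
  simp [kernelAvg]

theorem kernelAvg_eq_dilate (κ : E → F) (f : E → ℝ) {s : ℝ} (hs : 0 < s) (x : E) :
    kernelAvg κ f s x = kernelAvg κ (fun y => f (s • y)) 1 (s⁻¹ • x) := by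
  simp [kernelAvg, smul_smul, hs.ne']

theorem hasFDerivAt_kernelAvg_one {κ : E → F} (hκ : Integrable κ) {κ' : E → E →L[ℝ] F}
    (hκ' : GaussianBounded κ') (h : ∀ z, HasFDerivAt κ (κ' z) z) {f : E → ℝ} (hf : Continuous f)
    {M : ℝ} (hM : ∀ x, |f x| ≤ M) (x : E) :
    HasFDerivAt (kernelAvg κ f 1) (-kernelAvg κ' f 1 x) x := by
  obtain ⟨A, hA, hb⟩ := hκ'.bound
  have hM0 : 0 ≤ M := (abs_nonneg _).trans (hM 0)
  have hint : Integrable (fun y => f y • κ (y - x)) :=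
    (hκ.comp_sub_right x).bdd_smul M hf.aestronglyMeasurable (Eventually.of_forall hM)
  have hc' := hκ'.continuous
  have hcκ : Continuous κ := continuous_iff_continuousAt.2 fun z => (h z).continuousAt
  have key := hasFDerivAt_integral_of_dominated_of_fderiv_le (𝕜 := ℝ) (μ := (volume : Measure E))
    (F := fun x y => f y • κ (y - x)) (F' := fun x y => -(f y • κ' (y - x))) (x₀ := x)
    (bound := fun y => M * (A * (exp (1 / 4) * exp (-(1 / 8) * ‖y - x‖ ^ 2))))
    (Metric.ball_mem_nhds x one_pos)
    (Eventually.of_forall fun x =>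
      (by fun_prop : Continuous fun y => f y • κ (y - x)).aestronglyMeasurable) hint
    (by fun_prop : Continuous fun y => -(f y • κ' (y - x))).aestronglyMeasurable
    (Eventually.of_forall fun y x' hx' => ?_) ?_ (Eventually.of_forall fun y x' _ => ?_)
  · have e1 : kernelAvg κ f 1 = fun x => ∫ y, f y • κ (y - x) :=
      funext fun x => kernelAvg_one_eq κ f x
    rw [e1, kernelAvg_one_eq, ← integral_neg]
    exact key
  · rw [norm_neg, norm_smul]
    have h1 : exp (-(1 / 4) * ‖y - x'‖ ^ 2) ≤ exp (1 / 4) * exp (-(1 / 8) * ‖y - x‖ ^ 2) := by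
      rw [← exp_add]
      refine exp_le_exp.2 ?_
      have h2 : ‖y - x‖ ≤ ‖y - x'‖ + ‖x' - x‖ := by
        simpa using norm_add_le (y - x') (x' - x)
      have h3 : ‖x' - x‖ < 1 := by simpa [dist_eq_norm] using hx'
      have h4 : ‖y - x‖ ≤ ‖y - x'‖ + 1 := by linarith
      nlinarith [norm_nonneg (y - x), norm_nonneg (y - x'), sq_nonneg (‖y - x'‖ - 1),
        pow_le_pow_left₀ (norm_nonneg _) h4 2]
    calc ‖f y‖ * ‖κ' (y - x')‖ ≤ M * (A * exp (-(1 / 4) * ‖y - x'‖ ^ 2)) := by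
          gcongr
          · exact hM y
          · exact hb _
      _ ≤ _ := by gcongr
  · exact ((((integrable_exp_neg_mul_norm_sq (E := E) (c := 1 / 8) (by norm_num)).comp_sub_right
      x).const_mul _).const_mul _).const_mul _
  · have h1 : HasFDerivAt (fun x' => y - x') (-ContinuousLinearMap.id ℝ E) x' :=
      (hasFDerivAt_id x').const_sub y
    have h2 := ((h (y - x')).comp x' h1).const_smul (f y)
    refine h2.congr_fderiv ?_
    ext v
    simp

theorem hasFDerivAt_kernelAvg {κ : E → F} (hκ : Integrable κ) {κ' : E → E →L[ℝ] F}
    (hκ' : GaussianBounded κ') (h : ∀ z, HasFDerivAt κ (κ' z) z) {f : E → ℝ} (hf : Continuous f)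
    {M : ℝ} (hM : ∀ x, |f x| ≤ M) {s : ℝ} (hs : 0 < s) (x : E) :
    HasFDerivAt (kernelAvg κ f s) (-(s⁻¹ • kernelAvg κ' f s x)) x := by
  have e1 : kernelAvg κ f s = fun x => kernelAvg κ (fun y => f (s • y)) 1 (s⁻¹ • x) :=
    funext fun x => kernelAvg_eq_dilate κ f hs x
  rw [e1, kernelAvg_eq_dilate κ' f hs]
  have h1 := hasFDerivAt_kernelAvg_one hκ hκ' h (f := fun y => f (s • y)) (by fun_prop)
    (fun x => hM _) (s⁻¹ • x)
  have h2 : HasFDerivAt (fun x : E => s⁻¹ • x) (s⁻¹ • ContinuousLinearMap.id ℝ E) x :=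
    (hasFDerivAt_id x).const_smul s⁻¹
  refine (h1.comp x h2).congr_fderiv ?_
  ext v
  simp

theorem kernelAvg_one_fderiv_eq_zero {κ : E → F} (hκ : Integrable κ) {κ' : E → E →L[ℝ] F}
    (hκ' : GaussianBounded κ') (h : ∀ z, HasFDerivAt κ (κ' z) z) : ∫ z, κ' z = 0 := by
  have h1 := hasFDerivAt_kernelAvg_one hκ hκ' h (f := fun _ => 1) continuous_const
    (M := 1) (fun _ => by simp) 0
  have h2 : kernelAvg κ (fun _ => 1) 1 = fun _ => ∫ z, κ z := by
    funext x; simp [kernelAvg]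
  rw [h2] at h1
  have h3 := h1.unique (hasFDerivAt_const _ _)
  simpa [kernelAvg] using h3

theorem GaussianBounded.of_le {V W : Type*} [NormedAddCommGroup V] [NormedAddCommGroup W]
    {κ : V → W} (hc : Continuous κ) {B : ℝ} (hB : 0 ≤ B)
    (h : ∀ z, ‖κ z‖ ≤ B * ((1 + ‖z‖ ^ 2) * exp (-(1 / 2) * ‖z‖ ^ 2))) : GaussianBounded κ := by
  refine ⟨hc, B * 5, by positivity, fun z => (h z).trans ?_⟩
  rw [mul_assoc]
  refine mul_le_mul_of_nonneg_left ?_ hB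
  have h1 : ‖z‖ ^ 2 * exp (-(1 / 2) * ‖z‖ ^ 2) ≤ 4 * exp (-(1 / 4) * ‖z‖ ^ 2) := by
    have := norm_sq_mul_exp_le (c := 1 / 2) (by norm_num) ‖z‖
    norm_num at this ⊢
    exact this
  have h2 : exp (-(1 / 2) * ‖z‖ ^ 2) ≤ exp (-(1 / 4) * ‖z‖ ^ 2) :=
    exp_le_exp.2 (by nlinarith [sq_nonneg ‖z‖])
  linarith [exp_pos (-(1 / 4) * ‖z‖ ^ 2)]

/-- The real inner product as a bilinear map. -/
def innerL (E : Type*) [NormedAddCommGroup E] [InnerProductSpace ℝ E] : E →L[ℝ] E →L[ℝ] ℝ :=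
  innerSL ℝ

@[simp] theorem innerL_apply {V : Type*} [NormedAddCommGroup V] [InnerProductSpace ℝ V]
    (x y : V) : innerL V x y = inner ℝ x y := rfl

@[simp] theorem norm_innerL_apply {V : Type*} [NormedAddCommGroup V] [InnerProductSpace ℝ V]
    (x : V) : ‖innerL V x‖ = ‖x‖ := innerSL_apply_norm (𝕜 := ℝ) x

theorem norm_innerL_le {V : Type*} [NormedAddCommGroup V] [InnerProductSpace ℝ V] :
    ‖innerL V‖ ≤ 1 :=
  ContinuousLinearMap.opNorm_le_bound _ zero_le_one fun x => by simp

variable (E) in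
/-- The normalizing constant of the standard Gaussian. -/
def gaussConst : ℝ := (∫ z : E, exp (-(1 / 2) * ‖z‖ ^ 2))⁻¹

variable (E) in
theorem gaussConst_pos : 0 < gaussConst E :=
  inv_pos.2 (integral_exp_pos (integrable_exp_neg_mul_norm_sq (by norm_num)))

/-- The standard Gaussian density. -/
def gauss (z : E) : ℝ := gaussConst E * exp (-(1 / 2) * ‖z‖ ^ 2)

/-- The derivative of the standard Gaussian density. -/
def gaussD (z : E) : E →L[ℝ] ℝ := -(gauss z • innerL E z)

/-- The second derivative of the standard Gaussian density. -/
def gaussD₂ (z : E) : E →L[ℝ] E →L[ℝ] ℝ :=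
  gauss z • ((innerL E z).smulRight (innerL E z) - innerL E)

theorem gauss_pos (z : E) : 0 < gauss z := mul_pos (gaussConst_pos E) (exp_pos _)

theorem continuous_gauss : Continuous (gauss (E := E)) := by
  unfold gauss; fun_prop

theorem gaussianBounded_gauss : GaussianBounded (gauss (E := E)) := by
  refine .of_le continuous_gauss (gaussConst_pos E).le fun z => ?_
  rw [norm_of_nonneg (gauss_pos z).le, gauss]
  have := gaussConst_pos E
  gcongr
  nlinarith [exp_pos (-(1 / 2) * ‖z‖ ^ 2), sq_nonneg ‖z‖,
    mul_nonneg (sq_nonneg ‖z‖) (exp_pos (-(1 / 2) * ‖z‖ ^ 2)).le]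

theorem gaussianBounded_gaussD : GaussianBounded (gaussD (E := E)) := by
  refine .of_le (by unfold gaussD; have := continuous_gauss (E := E); fun_prop)
    (gaussConst_pos E).le fun z => ?_
  have := gaussConst_pos E
  rw [gaussD, norm_neg, norm_smul, norm_of_nonneg (gauss_pos z).le, norm_innerL_apply, gauss,
    mul_assoc, mul_comm (exp _)]
  gcongr
  nlinarith [sq_nonneg (‖z‖ - 1)]

theorem gaussianBounded_gaussD₂ : GaussianBounded (gaussD₂ (E := E)) := by
  have hc : Continuous fun z : E => (innerL E z).smulRight (innerL E z) :=
    ((ContinuousLinearMap.smulRightL ℝ E (E →L[ℝ] ℝ)).continuous₂).comp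
      ((innerL E).continuous.prodMk (innerL E).continuous)
  refine .of_le (by unfold gaussD₂; have := continuous_gauss (E := E); fun_prop)
    (gaussConst_pos E).le fun z => ?_
  have := gaussConst_pos E
  rw [gaussD₂, norm_smul, norm_of_nonneg (gauss_pos z).le, gauss, mul_assoc, mul_comm (exp _)]
  gcongr
  refine (norm_sub_le _ _).trans ?_
  rw [ContinuousLinearMap.norm_smulRight_apply, norm_innerL_apply]
  nlinarith [norm_innerL_le (V := E)]

theorem integral_gauss : ∫ z : E, gauss z = 1 := by
  simp only [gauss, integral_const_mul, gaussConst]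
  exact inv_mul_cancel₀ (integral_exp_pos (integrable_exp_neg_mul_norm_sq (by norm_num))).ne'

theorem hasFDerivAt_gauss (z : E) : HasFDerivAt gauss (gaussD z) z := by
  have h : HasDerivAt (fun r => gaussConst E * exp (-(1 / 2) * r))
      (gaussConst E * (exp (-(1 / 2) * ‖z‖ ^ 2) * (-(1 / 2) * 1))) (‖z‖ ^ 2) :=
    (((hasDerivAt_id _).const_mul _).exp).const_mul _
  refine (hasFDerivAt_comp_norm_sq h).congr_fderiv ?_
  ext v
  simp [gaussD, gauss]
  exact Or.inl (by ring)

theorem hasFDerivAt_gaussD (z : E) : HasFDerivAt gaussD (gaussD₂ z) z := by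
  refine ((hasFDerivAt_gauss z).smul (innerL E).hasFDerivAt).neg.congr_fderiv ?_
  ext v w
  simp [gaussD, gaussD₂]
  ring

theorem integral_gaussD₂ : ∫ z : E, gaussD₂ z = 0 :=
  kernelAvg_one_fderiv_eq_zero gaussianBounded_gaussD.integrable gaussianBounded_gaussD₂
    hasFDerivAt_gaussD

theorem kernelAvg_eq_rescale (κ : E → F) (f : E → ℝ) {s : ℝ} (hs : 0 < s) (x : E) :
    kernelAvg κ f s x =
      (s⁻¹) ^ Module.finrank ℝ E • ∫ y, f (x + y) • κ (s⁻¹ • y) := by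
  have h := Measure.integral_comp_smul (volume : Measure E)
    (fun y => f (x + y) • κ (s⁻¹ • y)) s
  rw [abs_of_pos (by positivity), ← inv_pow] at h
  rw [← h]
  simp [kernelAvg, smul_smul, hs.ne']

theorem hasDerivAt_kernelAvg_gauss {f : E → ℝ} (hf : Continuous f)
    {M : ℝ} (hM : ∀ x, |f x| ≤ M) {s : ℝ} (hs : 0 < s) (x : E) :
    HasDerivAt (fun s => kernelAvg gauss f s x)
      (s⁻¹ * kernelAvg (fun z => (‖z‖ ^ 2 - Module.finrank ℝ E) * gauss z) f s x) s := by
  have hM0 : 0 ≤ M := (abs_nonneg _).trans (hM 0)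
  have hg := continuous_gauss (E := E)
  set d := Module.finrank ℝ E with hd
  have hgi : Integrable (gauss (E := E)) := gaussianBounded_gauss.integrable
  have hg2 : Integrable (fun z : E => ‖z‖ ^ 2 * gauss z) := by
    refine (gaussianBounded_gauss (E := E)).integrable_norm_sq_mul.congr
      (Eventually.of_forall fun z => ?_)
    simp [abs_of_pos (gauss_pos z)]
  have key := hasDerivAt_integral_of_dominated_loc_of_deriv_le (μ := (volume : Measure E))
    (F := fun s y => f (x + y) * gauss (s⁻¹ • y))
    (F' := fun s y => f (x + y) * (gauss (s⁻¹ • y) * (‖y‖ ^ 2 * s⁻¹ ^ 3))) (x₀ := s)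
    (bound := fun y => M * ((gaussConst E * exp (-(1 / (8 * s ^ 2)) * ‖y‖ ^ 2)) *
      (‖y‖ ^ 2 * (2 / s) ^ 3)))
    (Metric.ball_mem_nhds s (half_pos hs))
    (Eventually.of_forall fun s =>
      (by fun_prop : Continuous fun y => f (x + y) * gauss (s⁻¹ • y)).aestronglyMeasurable)
    ?_ (by fun_prop : Continuous fun y =>
      f (x + y) * (gauss (s⁻¹ • y) * (‖y‖ ^ 2 * s⁻¹ ^ 3))).aestronglyMeasurable
    (Eventually.of_forall fun y t ht => ?_) ?_ (Eventually.of_forall fun y t ht => ?_)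
  · have h1 : HasDerivAt (fun s : ℝ => s⁻¹ ^ d) (d * s⁻¹ ^ (d - 1) * (-(s ^ 2)⁻¹)) s :=
      (hasDerivAt_inv hs.ne').pow d
    have h2 := h1.mul key.2
    have h3 : (fun s => kernelAvg gauss f s x) =ᶠ[nhds s]
        fun s => s⁻¹ ^ d * ∫ y, f (x + y) * gauss (s⁻¹ • y) := by
      filter_upwards [lt_mem_nhds hs] with t ht
      rw [kernelAvg_eq_rescale _ _ ht]; rfl
    refine (h2.congr_of_eventuallyEq h3).congr_deriv ?_
    have h4 : kernelAvg (fun z => (‖z‖ ^ 2 - d) * gauss z) f s x =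
        kernelAvg (fun z => ‖z‖ ^ 2 * gauss z) f s x - d * kernelAvg gauss f s x := by
      simp only [kernelAvg]
      rw [← integral_const_mul, ← integral_sub (kernelAvg_integrable hg2 hf hM s x)
        ((kernelAvg_integrable hgi hf hM s x).const_mul _)]
      refine integral_congr_ae (Eventually.of_forall fun z => ?_)
      simp only [smul_eq_mul]
      ring
    rw [h4, kernelAvg_eq_rescale _ _ hs, kernelAvg_eq_rescale _ _ hs, ← hd]
    simp only [smul_eq_mul, norm_smul, mul_pow, norm_of_nonneg (inv_pos.2 hs).le]
    have h5 : ∫ y, f (x + y) * (gauss (s⁻¹ • y) * (‖y‖ ^ 2 * s⁻¹ ^ 3)) =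
        s⁻¹ * ∫ y, f (x + y) * (s⁻¹ ^ 2 * ‖y‖ ^ 2 * gauss (s⁻¹ • y)) := by
      rw [← integral_const_mul]
      refine integral_congr_ae (Eventually.of_forall fun z => ?_)
      simp only
      ring
    rw [h5]
    rcases Nat.eq_zero_or_pos d with h0 | h0
    · simp [h0]
    · obtain ⟨k, hk⟩ := Nat.exists_eq_succ_of_ne_zero h0.ne'
      rw [hk, Nat.succ_sub_one, ← inv_pow]
      generalize s⁻¹ = r
      rw [Nat.succ_eq_add_one, pow_succ r k]
      ring
  · have : Integrable (fun y : E => gauss (s⁻¹ • y)) := hgi.comp_smul (inv_pos.2 hs).ne'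
    exact this.bdd_mul (c := M) (by fun_prop : Continuous fun y => f (x + y)).aestronglyMeasurable
      (Eventually.of_forall fun y => hM _)
  · obtain ⟨ht1, ht2⟩ : s / 2 < t ∧ t < 3 * s / 2 := by
      rw [Metric.mem_ball, Real.dist_eq, abs_lt] at ht
      constructor <;> linarith
    have ht0 : 0 < t := by linarith
    have hp := gauss_pos (t⁻¹ • y)
    have hc := gaussConst_pos E
    rw [norm_mul, norm_of_nonneg
      (show 0 ≤ gauss (t⁻¹ • y) * (‖y‖ ^ 2 * t⁻¹ ^ 3) by positivity)]
    have i1 : t⁻¹ ≤ 2 / s := by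
      rw [inv_le_comm₀ ht0 (by positivity)]; rw [inv_div]; exact ht1.le
    have i2 : 1 / (8 * s ^ 2) * ‖y‖ ^ 2 ≤ 1 / 2 * ‖t⁻¹ • y‖ ^ 2 := by
      rw [norm_smul, norm_of_nonneg (inv_pos.2 ht0).le, mul_pow, ← mul_assoc]
      gcongr
      rw [inv_pow, one_div, one_div, ← mul_inv]
      exact inv_anti₀ (by positivity) (by nlinarith)
    refine mul_le_mul (hM _) (mul_le_mul ?_ (by gcongr) (by positivity) (by positivity))
      (by positivity) hM0
    exact mul_le_mul_of_nonneg_left (exp_le_exp.2 (by linarith)) hc.le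
  · have h1 : Continuous fun y : E => M * ((gaussConst E * exp (-(1 / (8 * s ^ 2)) * ‖y‖ ^ 2)) *
      (‖y‖ ^ 2 * (2 / s) ^ 3)) := by fun_prop
    have hc := gaussConst_pos E
    refine ((integrable_exp_neg_mul_norm_sq (E := E) (c := 1 / (8 * s ^ 2) / 2)
      (by positivity)).const_mul (M * gaussConst E * (2 / s) ^ 3 * (2 / (1 / (8 * s ^ 2))))).mono'
      h1.aestronglyMeasurable (Eventually.of_forall fun y => ?_)
    rw [norm_of_nonneg (by positivity)]
    have := norm_sq_mul_exp_le (c := 1 / (8 * s ^ 2)) (by positivity) ‖y‖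
    calc _ = M * gaussConst E * (2 / s) ^ 3 * (‖y‖ ^ 2 * exp (-(1 / (8 * s ^ 2)) * ‖y‖ ^ 2)) := by
          ring
      _ ≤ M * gaussConst E * (2 / s) ^ 3 * (2 / (1 / (8 * s ^ 2)) *
          exp (-(1 / (8 * s ^ 2) / 2) * ‖y‖ ^ 2)) := by gcongr
      _ = _ := by ring
  · obtain ⟨ht1, ht2⟩ : s / 2 < t ∧ t < 3 * s / 2 := by
      rw [Metric.mem_ball, Real.dist_eq, abs_lt] at ht
      constructor <;> linarith
    have ht0 : 0 < t := by linarith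
    have e1 : (fun t : ℝ => f (x + y) * gauss (t⁻¹ • y)) =
        fun t => f (x + y) * (gaussConst E * exp (-(1 / 2) * (t⁻¹ ^ 2 * ‖y‖ ^ 2))) := by
      funext t
      simp [gauss, norm_smul, mul_pow]
    rw [e1]
    have e2 := (((((((hasDerivAt_inv ht0.ne').pow 2).mul_const (‖y‖ ^ 2)).const_mul
      (-(1 / 2))).exp).const_mul (gaussConst E)).const_mul (f (x + y)))
    refine e2.congr_deriv ?_
    simp [gauss, norm_smul, mul_pow]
    exact Or.inl (by field_simp)

end Gaussian

section Resolvent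

set_option maxSynthPendingDepth 3

variable {E F : Type*} [NormedAddCommGroup E] [InnerProductSpace ℝ E] [FiniteDimensional ℝ E]
  [MeasurableSpace E] [BorelSpace E] [NormedAddCommGroup F] [NormedSpace ℝ F]

/-- The resolvent `(K - Δ)⁻¹`, written as an integral of Gaussian averages. -/
def gaussResolvent (K : ℝ) (f : E → ℝ) (x : E) : ℝ :=
  ∫ s in Set.Ioi 0, (s * exp (-(K / 2) * s ^ 2)) • kernelAvg gauss f s x

/-- The candidate for the first derivative of the resolvent. -/
def gaussResolventD (K : ℝ) (f : E → ℝ) (x : E) : E →L[ℝ] ℝ :=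
  ∫ s in Set.Ioi 0, (-exp (-(K / 2) * s ^ 2)) • kernelAvg gaussD f s x

/-- The candidate for the second derivative of the resolvent. -/
def gaussResolventD₂ (K : ℝ) (f : E → ℝ) (x : E) : E →L[ℝ] E →L[ℝ] ℝ :=
  ∫ s in Set.Ioi 0, (s⁻¹ * exp (-(K / 2) * s ^ 2)) • kernelAvg gaussD₂ f s x

theorem continuous_kernelAvg_left {κ : E → F} (hκ : Integrable κ) {f : E → ℝ} (hf : Continuous f)
    {M : ℝ} (hM : ∀ x, |f x| ≤ M) (x : E) : Continuous (fun s => kernelAvg κ f s x) :=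
  (continuous_kernelAvg hκ hf hM).comp (continuous_id.prodMk continuous_const)

theorem continuous_kernelAvg_right {κ : E → F} (hκ : Integrable κ) {f : E → ℝ}
    (hf : Continuous f) {M : ℝ} (hM : ∀ x, |f x| ≤ M) (s : ℝ) : Continuous (kernelAvg κ f s) :=
  (continuous_kernelAvg hκ hf hM).comp (continuous_const.prodMk continuous_id)

theorem integrable_smul_kernelAvg {κ : E → F} (hκ : Integrable κ) {f : E → ℝ}
    (hf : Continuous f) {M : ℝ} (hM : ∀ x, |f x| ≤ M) {ω : ℝ → ℝ}
    (hω : IntegrableOn ω (Set.Ioi 0)) (x : E) :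
    IntegrableOn (fun s => ω s • kernelAvg κ f s x) (Set.Ioi 0) :=
  Integrable.smul_bdd hω (M * ∫ z, ‖κ z‖)
    (continuous_kernelAvg_left hκ hf hM x).aestronglyMeasurable
    (Eventually.of_forall fun _ => norm_kernelAvg_le hκ hM _ _)

theorem integrableOn_mul_exp {K : ℝ} (hK : 0 < K) :
    IntegrableOn (fun s : ℝ => s * exp (-(K / 2) * s ^ 2)) (Set.Ioi 0) :=
  (integrable_mul_exp_neg_mul_sq (half_pos hK)).integrableOn

theorem integrableOn_neg_exp {K : ℝ} (hK : 0 < K) :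
    IntegrableOn (fun s : ℝ => -exp (-(K / 2) * s ^ 2)) (Set.Ioi 0) :=
  (integrable_exp_neg_mul_sq (half_pos hK)).integrableOn.neg

theorem gaussResolvent_mono {K : ℝ} (hK : 0 < K) {f g : E → ℝ} (hf : Continuous f)
    (hg : Continuous g) {M : ℝ} (hfM : ∀ x, |f x| ≤ M) (hgM : ∀ x, |g x| ≤ M) (h : ∀ x, f x ≤ g x) (x : E) :
    gaussResolvent K f x ≤ gaussResolvent K g x := by
  have hκ := (gaussianBounded_gauss (E := E)).integrable
  refine setIntegral_mono_on (integrable_smul_kernelAvg hκ hf hfM (integrableOn_mul_exp hK) x)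
    (integrable_smul_kernelAvg hκ hg hgM (integrableOn_mul_exp hK) x) measurableSet_Ioi
    fun s (hs : 0 < s) => ?_
  refine mul_le_mul_of_nonneg_left ?_ (by positivity)
  refine integral_mono (kernelAvg_integrable hκ hf hfM s x) (kernelAvg_integrable hκ hg hgM s x)
    fun z => ?_
  exact mul_le_mul_of_nonneg_right (h _) (gauss_pos z).le

theorem abs_gaussResolvent_le {K : ℝ} (hK : 0 < K) {f : E → ℝ}
    {M : ℝ} (hM : ∀ x, |f x| ≤ M) (x : E) :
    |gaussResolvent K f x| ≤ ∫ s in Set.Ioi (0 : ℝ), (s * exp (-(K / 2) * s ^ 2)) *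
      (M * ∫ z : E, ‖gauss z‖) := by
  refine norm_integral_le_of_norm_le (G := ℝ) ((integrableOn_mul_exp hK).mul_const _) ?_
  refine (ae_restrict_iff' measurableSet_Ioi).2 (Eventually.of_forall fun s (hs : 0 < s) => ?_)
  have h : 0 ≤ s * exp (-(K / 2) * s ^ 2) := by positivity
  rw [norm_smul, norm_of_nonneg h]
  exact mul_le_mul_of_nonneg_left
    (norm_kernelAvg_le gaussianBounded_gauss.integrable hM _ _) h

theorem tendsto_gaussResolvent {K : ℝ} (hK : 0 < K) {f : ℕ → E → ℝ} {g : E → ℝ}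
    (hf : ∀ k, Continuous (f k)) {M : ℝ} (hM : ∀ k x, |f k x| ≤ M)
    (h : ∀ x, Tendsto (fun k => f k x) atTop (nhds (g x))) (x : E) :
    Tendsto (fun k => gaussResolvent K (f k) x) atTop (nhds (gaussResolvent K g x)) := by
  have hκ := (gaussianBounded_gauss (E := E)).integrable
  refine tendsto_integral_of_dominated_convergence
    (fun s => ‖s * exp (-(K / 2) * s ^ 2)‖ * (M * ∫ z : E, ‖gauss z‖))
    (fun k => (integrable_smul_kernelAvg hκ (hf k) (hM k)
      (integrableOn_mul_exp hK) x).aestronglyMeasurable)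
    ((integrableOn_mul_exp hK).norm.mul_const _)
    (fun k => Eventually.of_forall fun s => ?_) (Eventually.of_forall fun s => ?_)
  · rw [norm_smul]
    exact mul_le_mul_of_nonneg_left (norm_kernelAvg_le hκ (hM k) _ _) (norm_nonneg _)
  · refine Tendsto.const_smul ?_ _
    refine tendsto_integral_of_dominated_convergence (fun z => M * ‖gauss z‖)
      (fun k => (kernelAvg_integrable hκ (hf k) (hM k) s x).aestronglyMeasurable)
      (hκ.norm.const_mul _) (fun k => Eventually.of_forall fun z => ?_)
      (Eventually.of_forall fun z => (h _).smul_const _)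
    rw [norm_smul]
    exact mul_le_mul_of_nonneg_right (hM k _) (norm_nonneg _)

theorem hasFDerivAt_gaussResolvent {K : ℝ} (hK : 0 < K) {f : E → ℝ} (hf : Continuous f)
    {M : ℝ} (hM : ∀ x, |f x| ≤ M) (x : E) :
    HasFDerivAt (gaussResolvent K f) (gaussResolventD K f x) x := by
  have hκ := (gaussianBounded_gauss (E := E)).integrable
  have hκ1 := (gaussianBounded_gaussD (E := E)).integrable
  refine hasFDerivAt_integral_of_dominated_of_fderiv_le (𝕜 := ℝ)
    (F := fun x s => (s * exp (-(K / 2) * s ^ 2)) • kernelAvg gauss f s x)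
    (F' := fun x s => (-exp (-(K / 2) * s ^ 2)) • kernelAvg gaussD f s x) (x₀ := x)
    (bound := fun s => ‖-exp (-(K / 2) * s ^ 2)‖ * (M * ∫ z : E, ‖gaussD z‖)) univ_mem
    (Eventually.of_forall fun x => (integrable_smul_kernelAvg hκ hf hM
      (integrableOn_mul_exp hK) x).aestronglyMeasurable)
    (integrable_smul_kernelAvg hκ hf hM (integrableOn_mul_exp hK) x)
    (integrable_smul_kernelAvg hκ1 hf hM (integrableOn_neg_exp hK) x).aestronglyMeasurable
    (Eventually.of_forall fun s x _ => ?_)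
    ((integrableOn_neg_exp hK).norm.mul_const _)
    ((ae_restrict_iff' measurableSet_Ioi).2 (Eventually.of_forall fun s (hs : 0 < s) x _ => ?_))
  · rw [norm_smul]
    exact mul_le_mul_of_nonneg_left (norm_kernelAvg_le hκ1 hM _ _) (norm_nonneg _)
  · refine ((hasFDerivAt_kernelAvg hκ gaussianBounded_gaussD hasFDerivAt_gauss hf hM hs
      x).const_smul (s * exp (-(K / 2) * s ^ 2))).congr_fderiv ?_
    rw [smul_neg, smul_smul, neg_smul]
    congr 2
    field_simp

theorem abs_gaussResolvent_sub_le {K : ℝ} (hK : 0 < K) {f : E → ℝ} (hf : Continuous f)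
    {M : ℝ} (hM : ∀ x, |f x| ≤ M) (x y : E) :
    |gaussResolvent K f x - gaussResolvent K f y| ≤
      (∫ s in Set.Ioi (0 : ℝ), ‖-exp (-(K / 2) * s ^ 2)‖ * (M * ∫ z : E, ‖gaussD z‖)) * ‖x - y‖ := by
  refine convex_univ.norm_image_sub_le_of_norm_hasFDerivWithin_le (𝕜 := ℝ) (f := gaussResolvent K f)
    (fun z _ => (hasFDerivAt_gaussResolvent hK hf hM z).hasFDerivWithinAt) (fun z _ => ?_)
    (Set.mem_univ _) (Set.mem_univ _)
  refine norm_integral_le_of_norm_le ((integrableOn_neg_exp hK).norm.mul_const _)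
    (Eventually.of_forall fun s => ?_)
  rw [norm_smul]
  exact mul_le_mul_of_nonneg_left
    (norm_kernelAvg_le gaussianBounded_gaussD.integrable hM _ _) (norm_nonneg _)

theorem norm_kernelAvg_le_of_holder {κ : E → F} (hκ : GaussianBounded κ) (h0 : ∫ z, κ z = 0)
    {f : E → ℝ} (hf : Continuous f) {M : ℝ} (hM : ∀ x, |f x| ≤ M) {α H : ℝ} (hα : 0 < α)
    (hα1 : α < 1) (hH : 0 ≤ H) {x : E} (hx : ∀ y, |f y - f x| ≤ H * ‖y - x‖ ^ α)
    {s : ℝ} (hs : 0 < s) :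
    ‖kernelAvg κ f s x‖ ≤ s ^ α * (H * ∫ z, (‖κ z‖ + ‖z‖ ^ 2 * ‖κ z‖)) := by
  have h1 : kernelAvg κ f s x = ∫ z, (f (x + s • z) - f x) • κ z := by
    simp only [sub_smul]
    rw [integral_sub (kernelAvg_integrable hκ.integrable hf hM s x)
      (show Integrable (fun z => f x • κ z) from hκ.integrable.smul _),
      integral_smul, h0, smul_zero, sub_zero]
    rfl
  rw [h1, ← integral_const_mul, ← integral_const_mul]
  refine norm_integral_le_of_norm_le
    (((hκ.integrable.norm.add hκ.integrable_norm_sq_mul).const_mul _).const_mul _)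
    (Eventually.of_forall fun z => ?_)
  have h2 : ‖z‖ ^ α ≤ 1 + ‖z‖ ^ 2 := by
    rcases le_total ‖z‖ 1 with h | h
    · have := rpow_le_one (norm_nonneg z) h hα.le
      nlinarith [sq_nonneg ‖z‖]
    · have := rpow_le_rpow_of_exponent_le h (show α ≤ 2 by linarith)
      rw [rpow_two] at this
      linarith
  have h3 : |f (x + s • z) - f x| ≤ H * (s ^ α * ‖z‖ ^ α) := by
    have := hx (x + s • z)
    rwa [add_sub_cancel_left, norm_smul, norm_of_nonneg hs.le,
      mul_rpow hs.le (norm_nonneg z)] at this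
  rw [norm_smul, norm_eq_abs]
  calc |f (x + s • z) - f x| * ‖κ z‖ ≤ H * (s ^ α * (1 + ‖z‖ ^ 2)) * ‖κ z‖ := by
        gcongr
        exact h3.trans (by gcongr)
    _ = _ := by ring

/-- Hölder continuity at every point near `x₀`, uniformly, with the comparison point arbitrary. -/
def HolderNear (α : ℝ) (f : E → ℝ) (x₀ : E) : Prop :=
  ∃ ε > 0, ∃ H, 0 ≤ H ∧ ∀ x ∈ Metric.ball x₀ ε, ∀ y, |f y - f x| ≤ H * ‖y - x‖ ^ α

theorem integrableOn_inv_mul_exp_mul_rpow {K α : ℝ} (hK : 0 < K) (hα : 0 < α) :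
    IntegrableOn (fun s : ℝ => s⁻¹ * exp (-(K / 2) * s ^ 2) * s ^ α) (Set.Ioi 0) := by
  refine (integrableOn_rpow_mul_exp_neg_mul_sq (half_pos hK) (s := α - 1) (by linarith)).congr_fun
    (fun s (hs : 0 < s) => ?_) measurableSet_Ioi
  change s ^ (α - 1) * _ = _
  rw [rpow_sub_one hs.ne']
  ring

theorem norm_smul_kernelAvg_gaussD₂_le {K : ℝ} {f : E → ℝ} (hf : Continuous f)
    {M : ℝ} (hM : ∀ x, |f x| ≤ M) {α H : ℝ} (hα : 0 < α) (hα1 : α < 1) (hH : 0 ≤ H)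
    {x : E} (hx : ∀ y, |f y - f x| ≤ H * ‖y - x‖ ^ α) {s : ℝ} (hs : 0 < s) :
    ‖(s⁻¹ * exp (-(K / 2) * s ^ 2)) • kernelAvg gaussD₂ f s x‖ ≤
      s⁻¹ * exp (-(K / 2) * s ^ 2) * s ^ α *
        (H * ∫ z : E, (‖gaussD₂ z‖ + ‖z‖ ^ 2 * ‖gaussD₂ z‖)) := by
  rw [norm_smul, norm_of_nonneg (by positivity), mul_assoc _ (s ^ α)]
  exact mul_le_mul_of_nonneg_left (norm_kernelAvg_le_of_holder gaussianBounded_gaussD₂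
    integral_gaussD₂ hf hM hα hα1 hH hx hs) (by positivity)

theorem aestronglyMeasurable_smul_kernelAvg_gaussD₂ (K : ℝ) {f : E → ℝ} (hf : Continuous f)
    {M : ℝ} (hM : ∀ x, |f x| ≤ M) (x : E) :
    AEStronglyMeasurable (fun s : ℝ => (s⁻¹ * exp (-(K / 2) * s ^ 2)) • kernelAvg gaussD₂ f s x)
      (volume.restrict (Set.Ioi 0)) := by
  have h : AEStronglyMeasurable (fun s : ℝ => s⁻¹ * exp (-(K / 2) * s ^ 2))
      (volume.restrict (Set.Ioi 0)) :=
    (by fun_prop : Measurable fun s : ℝ => s⁻¹ * exp (-(K / 2) * s ^ 2)).aestronglyMeasurable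
  exact h.smul (continuous_kernelAvg_left
    (gaussianBounded_gaussD₂ (E := E)).integrable hf hM x).aestronglyMeasurable

theorem integrable_smul_kernelAvg_gaussD₂ {K : ℝ} (hK : 0 < K) {f : E → ℝ} (hf : Continuous f)
    {M : ℝ} (hM : ∀ x, |f x| ≤ M) {α : ℝ} (hα : 0 < α) (hα1 : α < 1) {x : E}
    (hx : HolderNear α f x) :
    IntegrableOn (fun s : ℝ => (s⁻¹ * exp (-(K / 2) * s ^ 2)) • kernelAvg gaussD₂ f s x)
      (Set.Ioi 0) := by
  obtain ⟨ε, hε, H, hH, h⟩ := hx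
  exact ((integrableOn_inv_mul_exp_mul_rpow hK hα).mul_const _).mono'
    (aestronglyMeasurable_smul_kernelAvg_gaussD₂ K hf hM x)
    ((ae_restrict_iff' measurableSet_Ioi).2 (Eventually.of_forall fun s hs =>
      norm_smul_kernelAvg_gaussD₂_le hf hM hα hα1 hH (h x (Metric.mem_ball_self hε)) hs))

theorem hasFDerivAt_gaussResolventD {K : ℝ} (hK : 0 < K) {f : E → ℝ} (hf : Continuous f)
    {M : ℝ} (hM : ∀ x, |f x| ≤ M) {α : ℝ} (hα : 0 < α) (hα1 : α < 1) {x : E}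
    (hx : HolderNear α f x) : HasFDerivAt (gaussResolventD K f) (gaussResolventD₂ K f x) x := by
  have hκ1 := (gaussianBounded_gaussD (E := E)).integrable
  obtain ⟨ε, hε, H, hH, h⟩ := hx
  refine hasFDerivAt_integral_of_dominated_of_fderiv_le (𝕜 := ℝ)
    (F := fun x s => (-exp (-(K / 2) * s ^ 2)) • kernelAvg gaussD f s x)
    (F' := fun x s => (s⁻¹ * exp (-(K / 2) * s ^ 2)) • kernelAvg gaussD₂ f s x) (x₀ := x)
    (Metric.ball_mem_nhds x hε)
    (Eventually.of_forall fun x => (integrable_smul_kernelAvg hκ1 hf hM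
      (integrableOn_neg_exp hK) x).aestronglyMeasurable)
    (integrable_smul_kernelAvg hκ1 hf hM (integrableOn_neg_exp hK) x)
    (aestronglyMeasurable_smul_kernelAvg_gaussD₂ K hf hM x)
    ((ae_restrict_iff' measurableSet_Ioi).2 (Eventually.of_forall fun s hs y hy =>
      norm_smul_kernelAvg_gaussD₂_le hf hM hα hα1 hH (h y hy) hs))
    ((integrableOn_inv_mul_exp_mul_rpow hK hα).mul_const _)
    ((ae_restrict_iff' measurableSet_Ioi).2 (Eventually.of_forall fun s (hs : 0 < s) x _ => ?_))
  refine ((hasFDerivAt_kernelAvg hκ1 gaussianBounded_gaussD₂ hasFDerivAt_gaussD hf hM hs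
    x).const_smul (-exp (-(K / 2) * s ^ 2))).congr_fderiv ?_
  rw [smul_neg, smul_smul, ← neg_smul]
  congr 1
  ring

theorem continuousAt_gaussResolventD₂ {K : ℝ} (hK : 0 < K) {f : E → ℝ} (hf : Continuous f)
    {M : ℝ} (hM : ∀ x, |f x| ≤ M) {α : ℝ} (hα : 0 < α) (hα1 : α < 1) {x : E}
    (hx : HolderNear α f x) : ContinuousAt (gaussResolventD₂ K f) x := by
  obtain ⟨ε, hε, H, hH, h⟩ := hx
  refine continuousAt_of_dominated
    (Eventually.of_forall fun x => aestronglyMeasurable_smul_kernelAvg_gaussD₂ K hf hM x)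
    (by
      filter_upwards [Metric.ball_mem_nhds x hε] with y hy
      exact (ae_restrict_iff' measurableSet_Ioi).2 (Eventually.of_forall fun s hs =>
        norm_smul_kernelAvg_gaussD₂_le hf hM hα hα1 hH (h y hy) hs))
    ((integrableOn_inv_mul_exp_mul_rpow hK hα).mul_const _)
    (Eventually.of_forall fun s => ?_)
  exact ((continuous_kernelAvg_right (gaussianBounded_gaussD₂ (E := E)).integrable hf hM
    s).const_smul (s⁻¹ * exp (-(K / 2) * s ^ 2))).continuousAt

theorem contDiff_gaussResolvent {K : ℝ} (hK : 0 < K) {f : E → ℝ} (hf : Continuous f)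
    {M : ℝ} (hM : ∀ x, |f x| ≤ M) {α : ℝ} (hα : 0 < α) (hα1 : α < 1)
    (hH : ∀ x, HolderNear α f x) : ContDiff ℝ 2 (gaussResolvent K f) := by
  have h1 : ContDiff ℝ ((1 : ℕ) + 1) (gaussResolvent K f) := by
    refine contDiff_succ_iff_hasFDerivAt.2
      ⟨gaussResolventD K f, ?_, hasFDerivAt_gaussResolvent hK hf hM⟩
    have h2 := fun x => hasFDerivAt_gaussResolventD hK hf hM hα hα1 (hH x)
    refine contDiff_one_iff_fderiv.2 ⟨fun x => (h2 x).differentiableAt, ?_⟩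
    have h3 : fderiv ℝ (gaussResolventD K f) = gaussResolventD₂ K f := funext fun x => (h2 x).fderiv
    rw [h3]
    exact continuous_iff_continuousAt.2 fun x =>
      continuousAt_gaussResolventD₂ hK hf hM hα hα1 (hH x)
  exact_mod_cast h1

end Resolvent

section Laplacian

set_option maxSynthPendingDepth 3

variable {n : ℕ}

/-- The trace of a bilinear form on Euclidean space. -/
def bilinTrace (n : ℕ) :
    (EuclideanSpace ℝ (Fin n) →L[ℝ] EuclideanSpace ℝ (Fin n) →L[ℝ] ℝ) →L[ℝ] ℝ :=
  ∑ i, (ContinuousLinearMap.apply ℝ ℝ (EuclideanSpace.single i 1)).comp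
    (ContinuousLinearMap.apply ℝ (EuclideanSpace ℝ (Fin n) →L[ℝ] ℝ) (EuclideanSpace.single i 1))

theorem bilinTrace_apply (B : EuclideanSpace ℝ (Fin n) →L[ℝ] EuclideanSpace ℝ (Fin n) →L[ℝ] ℝ) :
    bilinTrace n B = ∑ i, B (EuclideanSpace.single i 1) (EuclideanSpace.single i 1) := by
  simp [bilinTrace]

theorem bilinTrace_gaussD₂ (z : EuclideanSpace ℝ (Fin n)) :
    bilinTrace n (gaussD₂ z) =
      (‖z‖ ^ 2 - Module.finrank ℝ (EuclideanSpace ℝ (Fin n))) * gauss z := by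
  rw [bilinTrace_apply]
  have h6 : ‖z‖ ^ 2 = ∑ i, z i ^ 2 := by simp [EuclideanSpace.norm_sq_eq]
  trans ∑ i, gauss z * (z i ^ 2 - 1)
  · refine Finset.sum_congr rfl fun i _ => ?_
    simp [gaussD₂, EuclideanSpace.inner_single_right]
    exact Or.inl (by ring)
  · rw [← Finset.mul_sum, Finset.sum_sub_distrib, ← h6]
    simp
    ring

theorem bilinTrace_kernelAvg {f : EuclideanSpace ℝ (Fin n) → ℝ} (hf : Continuous f)
    {M : ℝ} (hM : ∀ x, |f x| ≤ M) (s : ℝ) (x : EuclideanSpace ℝ (Fin n)) :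
    bilinTrace n (kernelAvg gaussD₂ f s x) = kernelAvg (fun z =>
      (‖z‖ ^ 2 - Module.finrank ℝ (EuclideanSpace ℝ (Fin n))) * gauss z) f s x := by
  rw [kernelAvg, ← ContinuousLinearMap.integral_comp_comm _
    (kernelAvg_integrable gaussianBounded_gaussD₂.integrable hf hM s x)]
  refine integral_congr_ae (Eventually.of_forall fun z => ?_)
  simp only [map_smul, bilinTrace_gaussD₂]

theorem lap_gaussResolvent {K : ℝ} (hK : 0 < K) {f : EuclideanSpace ℝ (Fin n) → ℝ}
    (hf : Continuous f) {M : ℝ} (hM : ∀ x, |f x| ≤ M) {α : ℝ} (hα : 0 < α) (hα1 : α < 1)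
    (hH : ∀ x, HolderNear α f x) (x : EuclideanSpace ℝ (Fin n)) :
    lap (gaussResolvent K f) x = K * gaussResolvent K f x - f x := by
  have hκ := (gaussianBounded_gauss (E := EuclideanSpace ℝ (Fin n))).integrable
  have hi2 := integrable_smul_kernelAvg_gaussD₂ hK hf hM hα hα1 (hH x)
  have hi2' := (bilinTrace n).integrable_comp hi2
  have hi0 := integrable_smul_kernelAvg hκ hf hM (integrableOn_mul_exp hK) x
  rw [lap_eq_of_hasFDerivAt (hasFDerivAt_gaussResolvent hK hf hM)
    (hasFDerivAt_gaussResolventD hK hf hM hα hα1 (hH x)), ← bilinTrace_apply, gaussResolventD₂,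
    ← ContinuousLinearMap.integral_comp_comm _ hi2]
  have hlim : Tendsto (fun s => exp (-(K / 2) * s ^ 2) * kernelAvg gauss f s x) atTop (nhds 0) := by
    refine squeeze_zero_norm (a := fun s => exp (-(K / 2) * s ^ 2) *
      (M * ∫ z : EuclideanSpace ℝ (Fin n), ‖gauss z‖)) (fun s => ?_) ?_
    · rw [norm_mul, norm_of_nonneg (exp_pos _).le]
      exact mul_le_mul_of_nonneg_left (norm_kernelAvg_le hκ hM _ _) (exp_pos _).le
    · have : Tendsto (fun s : ℝ => -(K / 2) * s ^ 2) atTop atBot :=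
        (tendsto_pow_atTop two_ne_zero).const_mul_atTop_of_neg (by linarith)
      simpa using (tendsto_exp_atBot.comp this).mul_const
        (M * ∫ z : EuclideanSpace ℝ (Fin n), ‖gauss z‖)
  have hder : ∀ s ∈ Set.Ioi (0 : ℝ), HasDerivAt
      (fun s => exp (-(K / 2) * s ^ 2) * kernelAvg gauss f s x)
      (bilinTrace n ((s⁻¹ * exp (-(K / 2) * s ^ 2)) • kernelAvg gaussD₂ f s x) -
        K * ((s * exp (-(K / 2) * s ^ 2)) • kernelAvg gauss f s x)) s := fun s (hs : 0 < s) => by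
    have h1 : HasDerivAt (fun s => exp (-(K / 2) * s ^ 2))
        (exp (-(K / 2) * s ^ 2) * (-(K / 2) * (2 * s))) s := by
      simpa using ((hasDerivAt_pow 2 s).const_mul (-(K / 2))).exp
    refine (h1.mul (hasDerivAt_kernelAvg_gauss hf hM hs x)).congr_deriv ?_
    rw [map_smul, bilinTrace_kernelAvg hf hM]
    simp only [smul_eq_mul]
    ring
  have key := integral_Ioi_of_hasDerivAt_of_tendsto
    (((by fun_prop : Continuous fun s : ℝ => exp (-(K / 2) * s ^ 2)).mul
      (continuous_kernelAvg_left hκ hf hM x)).continuousWithinAt) hder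
    (hi2'.sub (hi0.const_mul K)) hlim
  rw [integral_sub hi2' (hi0.const_mul K), integral_const_mul] at key
  have h0 : kernelAvg gauss f 0 x = f x := by
    simp [kernelAvg, integral_const_mul, integral_gauss]
  rw [show gaussResolvent K f x =
    ∫ s in Set.Ioi 0, (s * exp (-(K / 2) * s ^ 2)) • kernelAvg gauss f s x from rfl]
  simp [h0] at key ⊢
  linarith

end Laplacian

section Holder

variable {E : Type*} [NormedAddCommGroup E] {α : ℝ} {f g : E → ℝ}

/-- Local Hölder continuity of exponent `α`. -/
def LocHolder (α : ℝ) (f : E → ℝ) : Prop :=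
  ∀ x, ∃ ε > (0 : ℝ), ∃ K : ℝ, 0 ≤ K ∧
    ∀ y ∈ Metric.ball x ε, ∀ z ∈ Metric.ball x ε, |f y - f z| ≤ K * ‖y - z‖ ^ α

theorem LocHolder.continuous (hf : LocHolder α f) (hα : 0 < α) : Continuous f := by
  refine continuous_iff_continuousAt.2 fun x => ?_
  obtain ⟨ε, hε, K, hK, h⟩ := hf x
  refine tendsto_iff_norm_sub_tendsto_zero.2 ?_
  have h1 : Tendsto (fun y => K * ‖y - x‖ ^ α) (nhds x) (nhds 0) := by
    have : ContinuousAt (fun y => K * ‖y - x‖ ^ α) x :=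
      (ContinuousAt.rpow_const (by fun_prop) (Or.inr hα.le)).const_mul K
    simpa [ContinuousAt, zero_rpow hα.ne'] using this
  refine squeeze_zero' (Eventually.of_forall fun y => norm_nonneg _) ?_ h1
  filter_upwards [Metric.ball_mem_nhds x hε] with y hy
  exact h y hy x (Metric.mem_ball_self hε)

theorem LocHolder.holderNear (hf : LocHolder α f) (hα : 0 < α) {M : ℝ}
    (hM : ∀ x, |f x| ≤ M) (x₀ : E) : HolderNear α f x₀ := by
  obtain ⟨ε, hε, K, hK, h⟩ := hf x₀
  have hM0 : 0 ≤ M := (abs_nonneg _).trans (hM x₀)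
  have h2 : 0 < (ε / 2) ^ α := rpow_pos_of_pos (half_pos hε) α
  refine ⟨ε / 2, half_pos hε, K + 2 * M / (ε / 2) ^ α, by positivity, fun x hx y => ?_⟩
  have hp : 0 ≤ ‖y - x‖ ^ α := rpow_nonneg (norm_nonneg _) α
  by_cases hy : y ∈ Metric.ball x₀ ε
  · refine (h y hy x (Metric.ball_subset_ball (by linarith) hx)).trans ?_
    gcongr
    have : 0 ≤ 2 * M / (ε / 2) ^ α := by positivity
    linarith
  · have h3 : ε / 2 ≤ ‖y - x‖ := by
      rw [Metric.mem_ball, dist_eq_norm] at hx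
      rw [Metric.mem_ball, dist_eq_norm, not_lt] at hy
      have := norm_add_le (y - x) (x - x₀)
      rw [sub_add_sub_cancel] at this
      linarith
    have h4 : (ε / 2) ^ α ≤ ‖y - x‖ ^ α := rpow_le_rpow (half_pos hε).le h3 hα.le
    have h5 : |f y - f x| ≤ 2 * M := by
      have := abs_sub (f y) (f x)
      linarith [hM x, hM y]
    have h6 : 2 * M ≤ 2 * M / (ε / 2) ^ α * ‖y - x‖ ^ α := by
      rw [div_mul_eq_mul_div, le_div_iff₀ h2]
      gcongr
    have h7 : 0 ≤ K * ‖y - x‖ ^ α := by positivity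
    rw [add_mul]
    linarith

theorem LocHolder.add (hf : LocHolder α f) (hg : LocHolder α g) :
    LocHolder α (fun x => f x + g x) := fun x => by
  obtain ⟨ε, hε, K, hK, h⟩ := hf x
  obtain ⟨ε', hε', K', hK', h'⟩ := hg x
  refine ⟨min ε ε', lt_min hε hε', K + K', by positivity, fun y hy z hz => ?_⟩
  have h1 := h y (Metric.ball_subset_ball (min_le_left _ _) hy) z
    (Metric.ball_subset_ball (min_le_left _ _) hz)
  have h2 := h' y (Metric.ball_subset_ball (min_le_right _ _) hy) z
    (Metric.ball_subset_ball (min_le_right _ _) hz)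
  calc |f y + g y - (f z + g z)| = |(f y - f z) + (g y - g z)| := by ring_nf
    _ ≤ |f y - f z| + |g y - g z| := abs_add_le _ _
    _ ≤ _ := by rw [add_mul]; exact add_le_add h1 h2

theorem LocHolder.mul (hα : 0 < α) (hf : LocHolder α f) (hg : LocHolder α g) :
    LocHolder α (fun x => f x * g x) := fun x => by
  obtain ⟨ε, hε, K, hK, h⟩ := hf x
  obtain ⟨ε', hε', K', hK', h'⟩ := hg x
  have hb : ∀ {φ : E → ℝ}, LocHolder α φ → ∃ δ > 0, ∀ y ∈ Metric.ball x δ, |φ y| ≤ |φ x| + 1 := by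
    intro φ hφ
    obtain ⟨δ, hδ, hd⟩ := Metric.continuousAt_iff.1 (hφ.continuous hα).continuousAt 1 one_pos
    refine ⟨δ, hδ, fun y hy => ?_⟩
    have h1 := hd hy
    rw [dist_eq_norm, norm_eq_abs] at h1
    have h2 := abs_sub_abs_le_abs_sub (φ y) (φ x)
    linarith
  obtain ⟨δ, hδ, hfb⟩ := hb hf
  obtain ⟨δ', hδ', hgb⟩ := hb hg
  have hsub : ∀ y ∈ Metric.ball x (min (min ε ε') (min δ δ')), y ∈ Metric.ball x ε ∧
      y ∈ Metric.ball x ε' ∧ y ∈ Metric.ball x δ ∧ y ∈ Metric.ball x δ' := fun y hy => by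
    simpa [and_assoc] using hy
  refine ⟨min (min ε ε') (min δ δ'), by positivity,
    (|f x| + 1) * K' + K * (|g x| + 1), by positivity, fun y hy z hz => ?_⟩
  obtain ⟨hy1, hy2, hy3, hy4⟩ := hsub y hy
  obtain ⟨hz1, hz2, hz3, hz4⟩ := hsub z hz
  calc |f y * g y - f z * g z| = |f y * (g y - g z) + (f y - f z) * g z| := by ring_nf
    _ ≤ |f y| * |g y - g z| + |f y - f z| * |g z| := by
      rw [← abs_mul, ← abs_mul]; exact abs_add_le _ _
    _ ≤ (|f x| + 1) * (K' * ‖y - z‖ ^ α) + K * ‖y - z‖ ^ α * (|g x| + 1) := by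
      have := h y hy1 z hz1
      have := h' y hy2 z hz2
      have := hfb y hy3
      have := hgb z hz4
      gcongr
    _ = _ := by ring

theorem LocHolder.const_mul (hf : LocHolder α f) (c : ℝ) : LocHolder α (fun x => c * f x) :=
  fun x => by
  obtain ⟨ε, hε, K, hK, h⟩ := hf x
  refine ⟨ε, hε, |c| * K, by positivity, fun y hy z hz => ?_⟩
  rw [← mul_sub, abs_mul, mul_assoc]
  exact mul_le_mul_of_nonneg_left (h y hy z hz) (abs_nonneg c)

theorem LocHolder.comp_lipschitz (hf : LocHolder α f) {s : Set ℝ} (hs : ∀ x, f x ∈ s) {φ : ℝ → ℝ}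
    {L : ℝ} (hL : 0 ≤ L) (hφ : ∀ a ∈ s, ∀ b ∈ s, |φ a - φ b| ≤ L * |a - b|) :
    LocHolder α (fun x => φ (f x)) := fun x => by
  obtain ⟨ε, hε, K, hK, h⟩ := hf x
  refine ⟨ε, hε, L * K, by positivity, fun y hy z hz => ?_⟩
  rw [mul_assoc]
  exact (hφ _ (hs y) _ (hs z)).trans (mul_le_mul_of_nonneg_left (h y hy z hz) hL)

theorem locHolder_of_lipschitz_near (hα : α < 1)
    (h : ∀ x, ∃ s ∈ nhds x, ∃ L : ℝ, 0 ≤ L ∧ ∀ y ∈ s, ∀ z ∈ s, |f y - f z| ≤ L * ‖y - z‖) :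
    LocHolder α f := fun x => by
  obtain ⟨s, hs, L, hL, h⟩ := h x
  obtain ⟨ε, hε, hsub⟩ := Metric.mem_nhds_iff.1 hs
  refine ⟨min ε (1 / 2), by positivity, L, hL, fun y hy z hz => ?_⟩
  have hyz : ‖y - z‖ ≤ 1 := by
    have h1 := Metric.ball_subset_ball (min_le_right _ _) hy
    have h2 := Metric.ball_subset_ball (min_le_right _ _) hz
    have h3 := dist_triangle_right y z x
    rw [Metric.mem_ball] at h1 h2
    rw [← dist_eq_norm]
    linarith
  refine (h y (hsub (Metric.ball_subset_ball (min_le_left _ _) hy)) z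
    (hsub (Metric.ball_subset_ball (min_le_left _ _) hz))).trans ?_
  refine mul_le_mul_of_nonneg_left ?_ hL
  rcases (norm_nonneg (y - z)).eq_or_lt with h0 | h0
  · rw [← h0]; exact rpow_nonneg le_rfl _
  · simpa using rpow_le_rpow_of_exponent_ge h0 hyz hα.le

theorem locHolder_of_contDiff [NormedSpace ℝ E] (hα : α < 1) (hf : ContDiff ℝ 1 f) :
    LocHolder α f := by
  refine locHolder_of_lipschitz_near hα fun x => ?_
  obtain ⟨L, s, hs, h⟩ := hf.contDiffAt.exists_lipschitzOnWith (x := x)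
  refine ⟨s, hs, L, L.2, fun y hy z hz => ?_⟩
  simpa [dist_eq_norm] using h.dist_le_mul y hy z hz

end Holder

section MonotoneIteration

variable {n : ℕ}

theorem lap_norm_sq_add (c : ℝ) (x : EuclideanSpace ℝ (Fin n)) :
    lap (fun y => ‖y‖ ^ 2 + c) x = 2 * n := by
  have := lap_comp_norm_sq (n := n) (q := fun r => r + c) (q' := fun _ => 1) (q'' := fun _ => 0)
    (fun r _ => (hasDerivAt_id r).add_const c) (fun r _ => hasDerivAt_const r 1) x
  simpa using this

/-- A maximum principle for bounded functions on the whole space. -/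
theorem nonpos_of_mul_le_lap {z : EuclideanSpace ℝ (Fin n) → ℝ} (hz : ContDiff ℝ 2 z) {B : ℝ}
    (hB : ∀ x, z x ≤ B) {K : ℝ} (hK : 0 < K) (h : ∀ x, K * z x ≤ lap z x)
    (x : EuclideanSpace ℝ (Fin n)) : z x ≤ 0 := by
  set ρ : EuclideanSpace ℝ (Fin n) → ℝ := fun y => ‖y‖ ^ 2 + (2 * n + 1) / K with hρ
  have hρc : ContDiff ℝ 2 ρ := (contDiff_norm_sq ℝ).add contDiff_const
  have hq : ∀ ε > 0, z x - ε * ρ x ≤ 0 := fun ε hε => by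
    refine nonpos_of_lap_pos (q := fun y => z y - ε * ρ y) (hz.sub (contDiff_const.mul hρc))
      (fun δ hδ => ?_) (fun y hy => ?_) x
    · have h1 : Tendsto (fun y : EuclideanSpace ℝ (Fin n) => ‖y‖ ^ 2)
          (cocompact (EuclideanSpace ℝ (Fin n))) atTop :=
        (tendsto_pow_atTop two_ne_zero).comp tendsto_norm_cocompact_atTop
      filter_upwards [h1.eventually_ge_atTop (B / ε)] with y hy
      have h2 : B ≤ ε * ‖y‖ ^ 2 := by rwa [div_le_iff₀' hε] at hy
      have h3 : 0 ≤ ε * ((2 * n + 1) / K) := by positivity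
      have := hB y
      simp only [hρ, mul_add]
      linarith
    · rw [lap_sub_const_mul hz hρc, lap_norm_sq_add]
      have h1 : ε * ((2 * n + 1) / K) < z y := by
        have : 0 ≤ ε * ‖y‖ ^ 2 := by positivity
        simp only [hρ, mul_add] at hy
        linarith
      have h2 : ε * (2 * n + 1) < K * z y := by
        have := mul_lt_mul_of_pos_left h1 hK
        calc _ = K * (ε * ((2 * n + 1) / K)) := by field_simp
          _ < _ := this
      have := h y
      linarith
  have hlim : Tendsto (fun ε : ℝ => z x - ε * ρ x) (nhdsWithin 0 (Set.Ioi 0)) (nhds (z x)) := by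
    have : Tendsto (fun ε : ℝ => z x - ε * ρ x) (nhds 0) (nhds (z x - 0 * ρ x)) :=
      (by fun_prop : Continuous fun ε : ℝ => z x - ε * ρ x).continuousAt
    rw [zero_mul, sub_zero] at this
    exact this.mono_left nhdsWithin_le_nhds
  exact le_of_tendsto hlim (by filter_upwards [self_mem_nhdsWithin] with ε hε using hq ε hε)

theorem lap_sub {u v : EuclideanSpace ℝ (Fin n) → ℝ} (hu : ContDiff ℝ 2 u)
    (hv : ContDiff ℝ 2 v) (x : EuclideanSpace ℝ (Fin n)) :
    lap (fun y => u y - v y) x = lap u x - lap v x := by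
  simpa using lap_sub_const_mul hu hv 1 x

/-- The method of sub- and supersolutions for `Δu = K u - G(x, u)` with `G` nondecreasing in `u`. -/
theorem exists_solution_between {α : ℝ} (hα : 0 < α) (hα1 : α < 1) {K : ℝ} (hK : 0 < K)
    {G : EuclideanSpace ℝ (Fin n) → ℝ → ℝ} {a b B : ℝ}
    (hmono : ∀ x, MonotoneOn (G x) (Set.Icc a b)) (hcont : ∀ x, ContinuousOn (G x) (Set.Icc a b))
    (hB : ∀ x, ∀ t ∈ Set.Icc a b, |G x t| ≤ B)
    (hG : ∀ v, LocHolder α v → (∀ x, v x ∈ Set.Icc a b) → LocHolder α (fun x => G x (v x)))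
    {s t : EuclideanSpace ℝ (Fin n) → ℝ} (hs : ContDiff ℝ 2 s) (ht : ContDiff ℝ 2 t)
    (has : ∀ x, a ≤ s x) (hst : ∀ x, s x ≤ t x) (htb : ∀ x, t x ≤ b)
    (hsub : ∀ x, K * s x - G x (s x) ≤ lap s x) (hsup : ∀ x, lap t x ≤ K * t x - G x (t x)) :
    ∃ u, ContDiff ℝ 2 u ∧ (∀ x, s x ≤ u x) ∧ (∀ x, u x ≤ t x) ∧
      ∀ x, lap u x = K * u x - G x (u x) := by
  have hmem : ∀ {v : EuclideanSpace ℝ (Fin n) → ℝ}, (∀ x, s x ≤ v x ∧ v x ≤ t x) →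
      ∀ x, v x ∈ Set.Icc a b := fun hv x =>
    ⟨(has x).trans (hv x).1, (hv x).2.trans (htb x)⟩
  have hholder : ∀ {v : EuclideanSpace ℝ (Fin n) → ℝ}, LocHolder α v →
      (∀ x, s x ≤ v x ∧ v x ≤ t x) → LocHolder α (fun x => G x (v x)) :=
    fun hv hv' => hG _ hv (hmem hv')
  set T : (EuclideanSpace ℝ (Fin n) → ℝ) → EuclideanSpace ℝ (Fin n) → ℝ :=
    fun v => gaussResolvent K (fun x => G x (v x)) with hT
  have hTC : ∀ {v}, LocHolder α v → (∀ x, s x ≤ v x ∧ v x ≤ t x) → ContDiff ℝ 2 (T v) ∧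
      ∀ x, lap (T v) x = K * T v x - G x (v x) := fun {v} hv hv' => by
    have hb : ∀ x, |G x (v x)| ≤ B := fun x => hB x _ (hmem hv' x)
    have h1 := hholder hv hv'
    exact ⟨contDiff_gaussResolvent hK (h1.continuous hα) hb hα hα1 fun x => h1.holderNear hα hb x,
      lap_gaussResolvent hK (h1.continuous hα) hb hα hα1 fun x => h1.holderNear hα hb x⟩
  have hTbetween : ∀ {v}, LocHolder α v → (∀ x, s x ≤ v x ∧ v x ≤ t x) →
      ∀ x, s x ≤ T v x ∧ T v x ≤ t x := fun {v} hv hv' => by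
    obtain ⟨h1, h2⟩ := hTC hv hv'
    have hb := fun x => abs_le.1 (abs_gaussResolvent_le hK (fun x => hB x _ (hmem hv' x)) x)
    have hms : ∀ x, s x ∈ Set.Icc a b := hmem fun x => ⟨le_rfl, hst x⟩
    have hmt : ∀ x, t x ∈ Set.Icc a b := hmem fun x => ⟨hst x, le_rfl⟩
    refine fun x => ⟨sub_nonpos.1 ?_, sub_nonpos.1 ?_⟩
    · refine nonpos_of_mul_le_lap (z := fun y => s y - T v y) (hs.sub h1)
        (fun y => sub_le_sub (hms y).2 (hb y).1) hK (fun y => ?_) x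
      rw [lap_sub hs h1, h2]
      have := hsub y
      have := hmono y (hms y) (hmem hv' y) (hv' y).1
      linarith
    · refine nonpos_of_mul_le_lap (z := fun y => T v y - t y) (h1.sub ht)
        (fun y => sub_le_sub (hb y).2 (hmt y).1) hK (fun y => ?_) x
      rw [lap_sub h1 ht, h2]
      have := hsup y
      have := hmono y (hmem hv' y) (hmt y) (hv' y).2
      linarith
  set u : ℕ → EuclideanSpace ℝ (Fin n) → ℝ := fun k => T^[k] s with hu
  have hsucc : ∀ k, u (k + 1) = T (u k) := fun k => Function.iterate_succ_apply' T k s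
  have hinv : ∀ k, LocHolder α (u k) ∧ ∀ x, s x ≤ u k x ∧ u k x ≤ t x := fun k => by
    induction k with
    | zero => exact ⟨locHolder_of_contDiff hα1 (hs.of_le (by norm_num)), fun x => ⟨le_rfl, hst x⟩⟩
    | succ k ih =>
      rw [hsucc]
      exact ⟨locHolder_of_contDiff hα1 ((hTC ih.1 ih.2).1.of_le (by norm_num)),
        hTbetween ih.1 ih.2⟩
  have hGc : ∀ k, Continuous (fun x => G x (u k x)) := fun k =>
    (hholder (hinv k).1 (hinv k).2).continuous hα
  have hGB : ∀ k x, |G x (u k x)| ≤ B := fun k x => hB x _ (hmem (hinv k).2 x)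
  have hstep : ∀ k x, u k x ≤ u (k + 1) x := fun k => by
    induction k with
    | zero => exact fun x => ((hinv 1).2 x).1
    | succ k ih =>
      intro x
      rw [hsucc (k + 1)]
      nth_rw 1 [hsucc k]
      exact gaussResolvent_mono hK (hGc k) (hGc (k + 1)) (hGB k) (hGB (k + 1))
        (fun y => hmono y (hmem (hinv k).2 y) (hmem (hinv (k + 1)).2 y) (ih y)) x
  have hlim : ∀ x, Tendsto (fun k => u k x) atTop (nhds (⨆ k, u k x)) := fun x =>
    tendsto_atTop_ciSup (monotone_nat_of_le_succ fun k => hstep k x)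
      ⟨t x, by rintro _ ⟨k, rfl⟩; exact ((hinv k).2 x).2⟩
  set U : EuclideanSpace ℝ (Fin n) → ℝ := fun x => ⨆ k, u k x with hU
  have hUst : ∀ x, s x ≤ U x ∧ U x ≤ t x := fun x =>
    ⟨ge_of_tendsto' (hlim x) fun k => ((hinv k).2 x).1,
      le_of_tendsto' (hlim x) fun k => ((hinv k).2 x).2⟩
  have hUlip : LocHolder α U := by
    refine locHolder_of_lipschitz_near hα1 fun x => ?_
    refine ⟨Set.univ, univ_mem, |∫ r in Set.Ioi (0 : ℝ), ‖-exp (-(K / 2) * r ^ 2)‖ *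
      (B * ∫ z : EuclideanSpace ℝ (Fin n), ‖gaussD z‖)|, abs_nonneg _, fun y _ z _ => ?_⟩
    have h1 := (((hlim y).comp (tendsto_add_atTop_nat 1)).sub
      ((hlim z).comp (tendsto_add_atTop_nat 1))).abs
    refine le_of_tendsto' h1 fun k => ?_
    simp only [Function.comp_apply, hsucc]
    exact (abs_gaussResolvent_sub_le hK (hGc k) (hGB k) y z).trans
      (mul_le_mul_of_nonneg_right (le_abs_self _) (norm_nonneg _))
  have hfix : U = T U := funext fun x => by
    have h1 : Tendsto (fun k => T (u k) x) atTop (nhds (T U x)) :=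
      tendsto_gaussResolvent hK hGc hGB (fun y => by
        have h2 := (hcont y) (U y) (hmem hUst y)
        exact h2.tendsto.comp (tendsto_nhdsWithin_iff.2
          ⟨hlim y, Eventually.of_forall fun k => hmem (hinv k).2 y⟩)) x
    have h2 := (hlim x).comp (tendsto_add_atTop_nat 1)
    refine tendsto_nhds_unique h2 (h1.congr fun k => ?_)
    rw [Function.comp_apply, hsucc]
  obtain ⟨h1, h2⟩ := hTC hUlip hUst
  rw [← hfix] at h1 h2
  exact ⟨U, h1, fun x => (hUst x).1, fun x => (hUst x).2, h2⟩

end MonotoneIteration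

section Barrier

variable {n : ℕ}

/-- The radial barrier `(1 + |x|²)^p`. -/
def japanesePow (p : ℝ) (x : EuclideanSpace ℝ (Fin n)) : ℝ := (1 + ‖x‖ ^ 2) ^ p

theorem japanesePow_pos (p : ℝ) (x : EuclideanSpace ℝ (Fin n)) : 0 < japanesePow p x :=
  rpow_pos_of_pos (by positivity) p

theorem japanesePow_le_one {p : ℝ} (hp : p ≤ 0) (x : EuclideanSpace ℝ (Fin n)) :
    japanesePow p x ≤ 1 :=
  rpow_le_one_of_one_le_of_nonpos (by nlinarith [sq_nonneg ‖x‖]) hp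

theorem contDiff_japanesePow (p : ℝ) :
    ContDiff ℝ 2 (japanesePow p : EuclideanSpace ℝ (Fin n) → ℝ) :=
  (contDiff_const.add (contDiff_norm_sq ℝ)).rpow_const_of_ne fun x => by positivity

theorem one_add_norm_rpow_le {p : ℝ} (hp : p ≤ 0) (x : EuclideanSpace ℝ (Fin n)) :
    (1 + ‖x‖) ^ (2 * p) ≤ japanesePow p x := by
  rw [rpow_mul (by positivity), rpow_two]
  exact rpow_le_rpow_of_nonpos (by positivity) (by nlinarith [norm_nonneg x]) hp

theorem japanesePow_le {p : ℝ} (hp : p ≤ 0) (x : EuclideanSpace ℝ (Fin n)) :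
    japanesePow p x ≤ 2 ^ (-p) * (1 + ‖x‖) ^ (2 * p) := by
  have h : ((1 + ‖x‖) ^ 2 / 2) ^ p = 2 ^ (-p) * (1 + ‖x‖) ^ (2 * p) := by
    rw [div_rpow (by positivity) (by norm_num), rpow_mul (by positivity), rpow_two,
      rpow_neg (by norm_num), div_eq_inv_mul]
  rw [← h]
  exact rpow_le_rpow_of_nonpos (by positivity) (by nlinarith [sq_nonneg (1 - ‖x‖)]) hp

theorem hasDerivAt_one_add_rpow (p : ℝ) {r : ℝ} (hr : 0 ≤ r) :
    HasDerivAt (fun r : ℝ => (1 + r) ^ p) (p * (1 + r) ^ (p - 1)) r := by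
  simpa using ((hasDerivAt_id r).const_add 1).rpow_const (p := p)
    (Or.inl (by simp only [id]; positivity))

theorem radial_lap_rpow_le {β r : ℝ} (hβ : 0 < β) (hr : 0 ≤ r) :
    4 * r * (-(β / 2) * ((-(β / 2) - 1) * (1 + r) ^ (-(β / 2) - 1 - 1))) +
      2 * n * (-(β / 2) * (1 + r) ^ (-(β / 2) - 1)) ≤
    -(β * (n - 2 - β)) * (1 + r) ^ (-(β / 2) - 1) := by
  have h1 : r * (1 + r) ^ (-(β / 2) - 1 - 1) ≤ (1 + r) ^ (-(β / 2) - 1) := by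
    rw [rpow_sub_one (by positivity) (-(β / 2) - 1), ← mul_div_assoc, div_le_iff₀ (by positivity)]
    have := rpow_nonneg (show 0 ≤ 1 + r by positivity) (-(β / 2) - 1)
    nlinarith
  have h2 := mul_le_mul_of_nonneg_left h1 (show 0 ≤ β * (β + 2) by positivity)
  nlinarith

theorem lap_one_add_japanesePow_le {A β : ℝ} (hA : 0 ≤ A) (hβ : 0 < β)
    (x : EuclideanSpace ℝ (Fin n)) :
    lap (fun y => 1 + A * japanesePow (-(β / 2)) y) x ≤
      -(A * (β * (n - 2 - β)) * japanesePow (-(β / 2) - 1) x) := by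
  rw [show (fun y : EuclideanSpace ℝ (Fin n) => 1 + A * japanesePow (-(β / 2)) y) =
    fun y => (fun r : ℝ => 1 + A * (1 + r) ^ (-(β / 2))) (‖y‖ ^ 2) from rfl,
    lap_comp_norm_sq
      (fun r hr => ((hasDerivAt_one_add_rpow _ hr).const_mul A).const_add 1)
      (fun r hr => ((hasDerivAt_one_add_rpow _ hr).const_mul (-(β / 2))).const_mul A)]
  have := mul_le_mul_of_nonneg_left
    (radial_lap_rpow_le (n := n) hβ (sq_nonneg ‖x‖)) hA
  rw [japanesePow]
  linarith

theorem le_lap_exp_neg_japanesePow {A β : ℝ} (hA : 0 ≤ A) (hβ : 0 < β)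
    (x : EuclideanSpace ℝ (Fin n)) :
    A * (β * (n - 2 - β)) * japanesePow (-(β / 2) - 1) x *
      exp (-(A * japanesePow (-(β / 2)) x)) ≤
      lap (fun y => exp (-(A * japanesePow (-(β / 2)) y))) x := by
  have hd : ∀ r : ℝ, 0 ≤ r → HasDerivAt (fun r : ℝ => exp (-(A * (1 + r) ^ (-(β / 2)))))
      (exp (-(A * (1 + r) ^ (-(β / 2)))) * -(A * (-(β / 2) * (1 + r) ^ (-(β / 2) - 1)))) r :=
    fun r hr => ((hasDerivAt_one_add_rpow _ hr).const_mul A).neg.exp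
  rw [show (fun y : EuclideanSpace ℝ (Fin n) => exp (-(A * japanesePow (-(β / 2)) y))) =
    fun y => (fun r : ℝ => exp (-(A * (1 + r) ^ (-(β / 2))))) (‖y‖ ^ 2) from rfl,
    lap_comp_norm_sq hd (fun r hr => (hd r hr).mul
      (((hasDerivAt_one_add_rpow _ hr).const_mul (-(β / 2))).const_mul A).neg)]
  have h1 := mul_le_mul_of_nonneg_left
    (radial_lap_rpow_le (n := n) hβ (sq_nonneg ‖x‖)) hA
  rw [japanesePow, japanesePow]
  set e := exp (-(A * (1 + ‖x‖ ^ 2) ^ (-(β / 2))))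
  have he : 0 ≤ e := (exp_pos _).le
  have h2 := mul_le_mul_of_nonneg_left h1 he
  have h3 : 0 ≤ 4 * ‖x‖ ^ 2 * (e * (A * (-(β / 2) * (1 + ‖x‖ ^ 2) ^ (-(β / 2) - 1))) ^ 2) := by
    positivity
  linarith

theorem lap_japanesePow_neg {β : ℝ} (hβ : 0 < β) (hβ' : β < n - 2)
    (x : EuclideanSpace ℝ (Fin n)) : lap (japanesePow (-(β / 2))) x < 0 := by
  have h := lap_comp_norm_sq (n := n) (fun r hr => hasDerivAt_one_add_rpow (-(β / 2)) hr)
    (fun r hr => (hasDerivAt_one_add_rpow _ hr).const_mul (-(β / 2))) x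
  refine (h.trans_le (radial_lap_rpow_le (n := n) hβ (sq_nonneg ‖x‖))).trans_lt ?_
  have h1 : 0 < (1 + ‖x‖ ^ 2) ^ (-(β / 2) - 1) := rpow_pos_of_pos (by positivity) _
  have h2 : 0 < β * (n - 2 - β) := mul_pos hβ (by linarith)
  nlinarith [mul_pos h2 h1]

end Barrier

section Lichnerowicz

variable {n : ℕ}

theorem exists_lipschitz_rpow_Icc {a b : ℝ} (ha : 0 < a) (p : ℝ) :
    ∃ L, 0 ≤ L ∧ ∀ s ∈ Set.Icc a b, ∀ t ∈ Set.Icc a b, |s ^ p - t ^ p| ≤ L * |s - t| := by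
  have hpos : ∀ t ∈ Set.Icc a b, t ≠ 0 := fun t ht => (ha.trans_le ht.1).ne'
  obtain ⟨L, hL⟩ := isCompact_Icc.exists_bound_of_continuousOn (s := Set.Icc a b)
    (f := fun t : ℝ => p * t ^ (p - 1))
    (continuousOn_const.mul (continuousOn_id.rpow_const fun t ht => Or.inl (hpos t ht)))
  refine ⟨|L|, abs_nonneg L, fun s hs t ht => ?_⟩
  exact (convex_Icc a b).norm_image_sub_le_of_norm_hasDerivWithin_le (f := fun t : ℝ => t ^ p)
    (fun r hr => (hasDerivAt_rpow_const (Or.inl (hpos r hr))).hasDerivWithinAt)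
    (fun r hr => (hL r hr).trans (le_abs_self L)) ht hs

theorem exists_bound_rpow_Icc {a b : ℝ} (ha : 0 < a) (p : ℝ) :
    ∃ B, 0 ≤ B ∧ ∀ t ∈ Set.Icc a b, |t ^ p| ≤ B := by
  obtain ⟨B, hB⟩ := isCompact_Icc.exists_bound_of_continuousOn (s := Set.Icc a b)
    (f := fun t : ℝ => t ^ p)
    (continuousOn_id.rpow_const fun t ht => Or.inl (ha.trans_le ht.1).ne')
  exact ⟨|B|, abs_nonneg B, fun t ht => (hB t ht).trans (le_abs_self B)⟩

theorem sq_le_of_abs_le_rpow {C β : ℝ} (hβ : 0 < β) {τ : EuclideanSpace ℝ (Fin n) → ℝ}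
    (h : ∀ x, |τ x| ≤ C * (1 + ‖x‖) ^ (-1 - β / 2)) (x : EuclideanSpace ℝ (Fin n)) :
    τ x ^ 2 ≤ C ^ 2 * japanesePow (-(β / 2) - 1) x := by
  have h1 : τ x ^ 2 ≤ (C * (1 + ‖x‖) ^ (-1 - β / 2)) ^ 2 := by
    rw [← sq_abs (τ x)]
    exact pow_le_pow_left₀ (abs_nonneg _) (h x) 2
  refine h1.trans ?_
  rw [mul_pow]
  refine mul_le_mul_of_nonneg_left ?_ (sq_nonneg C)
  refine le_trans (le_of_eq ?_) (one_add_norm_rpow_le (by linarith) x)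
  rw [← rpow_natCast, ← rpow_mul (by positivity)]
  congr 1
  push_cast
  ring

theorem le_of_lichnerowicz {c d e₁ e₂ β C₁ C₂ : ℝ} (hc : 0 < c) (hd : 0 ≤ d) (he₁ : 0 ≤ e₁)
    (he₂ : e₂ ≤ 0) (hβ : 0 < β) (hβ' : β < n - 2) {τ w u v : EuclideanSpace ℝ (Fin n) → ℝ}
    (hu : ContDiff ℝ 2 u) (hv : ContDiff ℝ 2 v) (hu0 : ∀ x, 0 < u x)
    (hu1 : ∀ x, |u x - 1| ≤ C₁ * (1 + ‖x‖) ^ (-β)) (hv1 : ∀ x, |v x - 1| ≤ C₂ * (1 + ‖x‖) ^ (-β))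
    (hul : ∀ x, -c * lap u x + d * τ x ^ 2 * u x ^ e₁ = w x ^ 2 * u x ^ e₂)
    (hvl : ∀ x, -c * lap v x + d * τ x ^ 2 * v x ^ e₁ = w x ^ 2 * v x ^ e₂)
    (x : EuclideanSpace ℝ (Fin n)) : v x ≤ u x := by
  set ψ : EuclideanSpace ℝ (Fin n) → ℝ := japanesePow (-(β / 2)) with hψ
  have hψc : ContDiff ℝ 2 ψ := contDiff_japanesePow _
  have hq : ∀ ε > 0, v x ≤ u x + ε := fun ε hε => by
    have key := nonpos_of_lap_pos (q := fun y => (v y - u y) - ε * ψ y)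
      ((hv.sub hu).sub (contDiff_const.mul hψc)) (fun δ hδ => ?_) (fun y hy => ?_) x
    · have : ε * ψ x ≤ ε * 1 :=
        mul_le_mul_of_nonneg_left (japanesePow_le_one (by linarith) x) hε.le
      linarith
    · have h1 : Tendsto (fun y : EuclideanSpace ℝ (Fin n) => (C₁ + C₂) * (1 + ‖y‖) ^ (-β))
          (cocompact _) (nhds ((C₁ + C₂) * 0)) :=
        (((tendsto_rpow_neg_atTop hβ).comp (tendsto_const_nhds.add_atTop
          tendsto_id)).comp tendsto_norm_cocompact_atTop).const_mul _
      rw [mul_zero] at h1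
      filter_upwards [h1.eventually_le_const hδ] with y hy
      have h2 := (abs_le.1 (hu1 y)).1
      have h3 := (abs_le.1 (hv1 y)).2
      have h4 := mul_pos hε (japanesePow_pos (-(β / 2)) y)
      rw [add_mul] at hy
      linarith
    · have h4 := mul_pos hε (japanesePow_pos (-(β / 2)) y)
      have hlt : u y ≤ v y := by linarith
      rw [lap_sub_const_mul (hv.sub hu) hψc, lap_sub hv hu]
      have h5 := mul_neg_of_pos_of_neg hε (lap_japanesePow_neg hβ hβ' y)
      have h6 : u y ^ e₁ ≤ v y ^ e₁ := rpow_le_rpow (hu0 y).le hlt he₁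
      have h7 : v y ^ e₂ ≤ u y ^ e₂ := rpow_le_rpow_of_nonpos (hu0 y) hlt he₂
      have h8 := mul_le_mul_of_nonneg_left h6 (mul_nonneg hd (sq_nonneg (τ y)))
      have h9 := mul_le_mul_of_nonneg_left h7 (sq_nonneg (w y))
      have h10 : c * lap u y ≤ c * lap v y := by linarith [hul y, hvl y]
      have h11 := le_of_mul_le_mul_left h10 hc
      linarith
  exact le_of_forall_pos_le_add hq

theorem exists_lichnerowicz {α β C c d e₁ e₂ : ℝ} (hα : 0 < α) (hα1 : α < 1) (hc : 0 < c)
    (hd : 0 ≤ d) (hd1 : d ≤ 1) (he₁ : 1 ≤ e₁) (he₂ : e₂ ≤ 0) (hβ : 0 < β) (hβ' : β < n - 2)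
    (hC : 0 < C) {τ w : EuclideanSpace ℝ (Fin n) → ℝ}
    (hτh : LocHolder α τ) (hwh : LocHolder α w)
    (hτ : ∀ x, τ x ^ 2 ≤ C ^ 2 * japanesePow (-(β / 2) - 1) x)
    (hw : ∀ x, w x ^ 2 ≤ C ^ 2 * japanesePow (-(β / 2) - 1) x) :
    ∃ u : EuclideanSpace ℝ (Fin n) → ℝ, (∀ x, 0 < u x) ∧ ContDiff ℝ 2 u ∧
      (∃ C' > 0, ∀ x, |u x - 1| ≤ C' * (1 + ‖x‖) ^ (-β)) ∧
      ∀ x, -c * lap u x + d * τ x ^ 2 * u x ^ e₁ = w x ^ 2 * u x ^ e₂ := by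
  have hκ : 0 < β * (n - 2 - β) := mul_pos hβ (by linarith)
  set A : ℝ := C ^ 2 / (c * (β * (n - 2 - β))) with hA
  have hA0 : 0 < A := by positivity
  have hAκ : c * (A * (β * (n - 2 - β))) = C ^ 2 := by
    rw [hA, ← mul_assoc, mul_comm c, mul_assoc]
    exact div_mul_cancel₀ _ (by positivity)
  obtain ⟨L₁, hL₁, hL₁'⟩ := exists_lipschitz_rpow_Icc (b := 1 + A) (exp_pos (-A)) e₁
  obtain ⟨L₂, hL₂, hL₂'⟩ := exists_lipschitz_rpow_Icc (b := 1 + A) (exp_pos (-A)) e₂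
  obtain ⟨B₁, hB₁, hB₁'⟩ := exists_bound_rpow_Icc (b := 1 + A) (exp_pos (-A)) e₁
  obtain ⟨B₂, hB₂, hB₂'⟩ := exists_bound_rpow_Icc (b := 1 + A) (exp_pos (-A)) e₂
  have hP : ∀ x : EuclideanSpace ℝ (Fin n), C ^ 2 * japanesePow (-(β / 2) - 1) x ≤ C ^ 2 :=
    fun x => mul_le_of_le_one_right (sq_nonneg C) (japanesePow_le_one (by linarith) x)
  have hτC : ∀ x, d * τ x ^ 2 ≤ C ^ 2 := fun x =>
    (mul_le_of_le_one_left (sq_nonneg _) hd1).trans ((hτ x).trans (hP x))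
  have hwC : ∀ x, w x ^ 2 ≤ C ^ 2 := fun x => (hw x).trans (hP x)
  have hdτ : ∀ x, 0 ≤ d * τ x ^ 2 := fun x => mul_nonneg hd (sq_nonneg _)
  set K : ℝ := c⁻¹ * (C ^ 2 * L₂ + C ^ 2 * L₁) + 1 with hK
  have hK0 : 0 < K := by positivity
  set G : EuclideanSpace ℝ (Fin n) → ℝ → ℝ := fun x t =>
    K * t + c⁻¹ * (w x ^ 2 * t ^ e₂ + (-1) * (d * τ x ^ 2 * t ^ e₁)) with hG
  set ψ : EuclideanSpace ℝ (Fin n) → ℝ := japanesePow (-(β / 2)) with hψ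
  have hψ0 : ∀ x, 0 < ψ x := japanesePow_pos _
  have hψ1 : ∀ x, A * ψ x ≤ A := fun x =>
    mul_le_of_le_one_right hA0.le (japanesePow_le_one (by linarith) x)
  have hAψ : ∀ x, 0 ≤ A * ψ x := fun x => mul_nonneg hA0.le (hψ0 x).le
  have hψc : ContDiff ℝ 2 ψ := contDiff_japanesePow _
  have key : ∃ u, ContDiff ℝ 2 u ∧ (∀ x, exp (-(A * ψ x)) ≤ u x) ∧ (∀ x, u x ≤ 1 + A * ψ x) ∧
      ∀ x, lap u x = K * u x - G x (u x) := by
    refine exists_solution_between (n := n) hα hα1 hK0 (G := G)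
      (a := exp (-A)) (b := 1 + A)
      (B := K * (1 + A) + c⁻¹ * (C ^ 2 * B₂ + C ^ 2 * B₁))
      (s := fun x => exp (-(A * ψ x))) (t := fun x => 1 + A * ψ x)
      (fun x s hs t ht hst => ?_) (fun x => ?_) (fun x t ht => ?_) (fun v hv hv' => ?_)
      (contDiff_const.mul hψc).neg.exp (contDiff_const.add (contDiff_const.mul hψc))
      (fun x => exp_le_exp.2 (neg_le_neg (hψ1 x)))
      (fun x => ?_) (fun x => by linarith [hψ1 x]) (fun x => ?_) (fun x => ?_)
    · have h1 := (abs_le.1 (hL₁' t ht s hs)).2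
      have h2 := (abs_le.1 (hL₂' t ht s hs)).1
      have hts : 0 ≤ t - s := sub_nonneg.2 hst
      rw [abs_of_nonneg hts] at h1 h2
      have h3 := mul_le_mul_of_nonneg_left h1 (hdτ x)
      have h4 := mul_le_mul_of_nonneg_left h2 (sq_nonneg (w x))
      have h5 := mul_le_mul_of_nonneg_right (hτC x) (mul_nonneg hL₁ hts)
      have h6 := mul_le_mul_of_nonneg_right (hwC x) (mul_nonneg hL₂ hts)
      have h7 : -((C ^ 2 * L₂ + C ^ 2 * L₁) * (t - s)) ≤
          (w x ^ 2 * t ^ e₂ + (-1) * (d * τ x ^ 2 * t ^ e₁)) -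
          (w x ^ 2 * s ^ e₂ + (-1) * (d * τ x ^ 2 * s ^ e₁)) := by linarith
      have h8 := mul_le_mul_of_nonneg_left h7 (inv_pos.2 hc).le
      simp only [hG, hK]
      linarith
    · have h0 : ∀ t ∈ Set.Icc (exp (-A)) (1 + A), t ≠ 0 := fun t ht =>
        ((exp_pos _).trans_le ht.1).ne'
      have h1 : ContinuousOn (fun t : ℝ => t ^ e₁) (Set.Icc (exp (-A)) (1 + A)) :=
        continuousOn_id.rpow_const fun t ht => Or.inl (h0 t ht)
      have h2 : ContinuousOn (fun t : ℝ => t ^ e₂) (Set.Icc (exp (-A)) (1 + A)) :=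
        continuousOn_id.rpow_const fun t ht => Or.inl (h0 t ht)
      fun_prop
    · have ht0 : 0 < t := (exp_pos _).trans_le ht.1
      have h1 := mul_le_mul (hτC x) (hB₁' t ht) (abs_nonneg _) (sq_nonneg C)
      have h2 := mul_le_mul (hwC x) (hB₂' t ht) (abs_nonneg _) (sq_nonneg C)
      have h3 : |w x ^ 2 * t ^ e₂ + (-1) * (d * τ x ^ 2 * t ^ e₁)| ≤ C ^ 2 * B₂ + C ^ 2 * B₁ := by
        refine (abs_add_le _ _).trans ?_
        rw [abs_mul (w x ^ 2), abs_of_nonneg (sq_nonneg (w x)), abs_mul (-1), abs_neg, abs_one,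
          one_mul, abs_mul (d * τ x ^ 2), abs_of_nonneg (hdτ x)]
        exact add_le_add h2 h1
      refine (abs_add_le _ _).trans (add_le_add ?_ ?_)
      · rw [abs_of_pos (by positivity)]
        exact mul_le_mul_of_nonneg_left ht.2 hK0.le
      · rw [abs_mul, abs_of_pos (inv_pos.2 hc)]
        exact mul_le_mul_of_nonneg_left h3 (inv_pos.2 hc).le
    · have h1 := hv.comp_lipschitz hv' hL₁ hL₁'
      have h2 := hv.comp_lipschitz hv' hL₂ hL₂'
      simp only [hG, pow_two]
      exact (hv.const_mul K).add ((((hwh.mul hα hwh).mul hα h2).add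
        ((((hτh.mul hα hτh).const_mul d).mul hα h1).const_mul (-1))).const_mul c⁻¹)
    · have h1 : exp (-(A * ψ x)) ≤ 1 := exp_le_one_iff.2 (by linarith [hAψ x])
      linarith [hAψ x]
    · set s := exp (-(A * ψ x)) with hs
      have hs0 : 0 < s := exp_pos _
      have hs1 : s ≤ 1 := exp_le_one_iff.2 (by linarith [hAψ x])
      refine le_trans ?_ (le_lap_exp_neg_japanesePow hA0.le hβ x)
      have h1 : s ^ e₁ ≤ s := by
        simpa using rpow_le_rpow_of_exponent_ge hs0 hs1 he₁
      have h2 : d * τ x ^ 2 ≤ C ^ 2 * japanesePow (-(β / 2) - 1) x :=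
        (mul_le_of_le_one_left (sq_nonneg _) hd1).trans (hτ x)
      have h3 := mul_le_mul h2 h1 (rpow_pos_of_pos hs0 _).le
        (mul_nonneg (sq_nonneg C) (japanesePow_pos _ x).le)
      have h4 : 0 ≤ w x ^ 2 * s ^ e₂ := mul_nonneg (sq_nonneg _) (rpow_pos_of_pos hs0 _).le
      have h5 : -(w x ^ 2 * s ^ e₂ + (-1) * (d * τ x ^ 2 * s ^ e₁)) ≤
          c * (A * (β * (n - 2 - β))) * japanesePow (-(β / 2) - 1) x * s := by
        rw [hAκ]; linarith
      have h6 := mul_le_mul_of_nonneg_left h5 (inv_pos.2 hc).le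
      have h7 : c⁻¹ * (c * (A * (β * (n - 2 - β))) * japanesePow (-(β / 2) - 1) x * s) =
          A * (β * (n - 2 - β)) * japanesePow (-(β / 2) - 1) x * s := by field_simp
      simp only [hG]
      linarith
    · refine (lap_one_add_japanesePow_le hA0.le hβ x).trans ?_
      set t := 1 + A * ψ x with ht
      have ht1 : 1 ≤ t := by linarith [hAψ x]
      have h1 : t ^ e₂ ≤ 1 := rpow_le_one_of_one_le_of_nonpos ht1 he₂
      have h2 := mul_le_mul (hw x) h1 (rpow_pos_of_pos (by linarith) _).le
        (mul_nonneg (sq_nonneg C) (japanesePow_pos _ x).le)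
      have h3 : 0 ≤ d * τ x ^ 2 * t ^ e₁ :=
        mul_nonneg (hdτ x) (rpow_pos_of_pos (by linarith) _).le
      have h5 : w x ^ 2 * t ^ e₂ + (-1) * (d * τ x ^ 2 * t ^ e₁) ≤
          c * (A * (β * (n - 2 - β))) * japanesePow (-(β / 2) - 1) x := by
        rw [hAκ]; linarith
      have h6 := mul_le_mul_of_nonneg_left h5 (inv_pos.2 hc).le
      have h7 : c⁻¹ * (c * (A * (β * (n - 2 - β))) * japanesePow (-(β / 2) - 1) x) =
          A * (β * (n - 2 - β)) * japanesePow (-(β / 2) - 1) x := by field_simp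
      simp only [hG]
      linarith
  obtain ⟨u, hu, hsu, hut, hlap⟩ := key
  refine ⟨u, fun x => (exp_pos _).trans_le (hsu x), hu, ⟨A * 2 ^ (β / 2), by positivity,
    fun x => ?_⟩, fun x => ?_⟩
  · have h1 : ψ x ≤ 2 ^ (β / 2) * (1 + ‖x‖) ^ (-β) := by
      have := japanesePow_le (p := -(β / 2)) (by linarith) x
      rwa [neg_neg, show 2 * -(β / 2) = -β by ring] at this
    have h2 := mul_le_mul_of_nonneg_left h1 hA0.le
    have h3 := add_one_le_exp (-(A * ψ x))
    have h4 := hsu x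
    have h5 := hut x
    rw [mul_assoc]
    exact abs_le.2 ⟨by linarith, by linarith⟩
  · rw [hlap]
    simp only [hG]
    field_simp
    ring

end Lichnerowicz

/-- Existence and uniqueness of the solution to the
Lichnerowicz equation on Euclidean space with decaying locally Hölder data. -/
theorem stmt15 (n : ℕ) (hn : 3 ≤ n) (α β C : ℝ) (hα : α ∈ Set.Ioo (0 : ℝ) 1)
    (hβ : 0 < β) (hβ' : β < (n : ℝ) - 2) (hC : 0 < C)
    (τ w : EuclideanSpace ℝ (Fin n) → ℝ)
    (hτhol : ∀ x : EuclideanSpace ℝ (Fin n), ∃ ε > (0 : ℝ), ∃ K : ℝ, 0 ≤ K ∧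
      ∀ y ∈ Metric.ball x ε, ∀ z ∈ Metric.ball x ε, |τ y - τ z| ≤ K * ‖y - z‖ ^ α)
    (hwhol : ∀ x : EuclideanSpace ℝ (Fin n), ∃ ε > (0 : ℝ), ∃ K : ℝ, 0 ≤ K ∧
      ∀ y ∈ Metric.ball x ε, ∀ z ∈ Metric.ball x ε, |w y - w z| ≤ K * ‖y - z‖ ^ α)
    (hτdec : ∀ x, |τ x| ≤ C * (1 + ‖x‖) ^ (-1 - β / 2))
    (hwdec : ∀ x, |w x| ≤ C * (1 + ‖x‖) ^ (-1 - β / 2)) :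
    ∃ u : EuclideanSpace ℝ (Fin n) → ℝ,
      (∀ x, 0 < u x) ∧ ContDiff ℝ 2 u ∧
      (∃ C' > 0, ∀ x, |u x - 1| ≤ C' * (1 + ‖x‖) ^ (-β)) ∧
      (∀ x, -(4 * ((n : ℝ) - 1) / ((n : ℝ) - 2)) * lap u x
          + (((n : ℝ) - 1) / (n : ℝ)) * (τ x) ^ 2 * (u x) ^ (Nc n - 1)
          = (w x) ^ 2 * (u x) ^ (-(Nc n) - 1)) ∧
      (∀ v : EuclideanSpace ℝ (Fin n) → ℝ,
        (∀ x, 0 < v x) → ContDiff ℝ 2 v →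
        (∃ C'' > 0, ∀ x, |v x - 1| ≤ C'' * (1 + ‖x‖) ^ (-β)) →
        (∀ x, -(4 * ((n : ℝ) - 1) / ((n : ℝ) - 2)) * lap v x
            + (((n : ℝ) - 1) / (n : ℝ)) * (τ x) ^ 2 * (v x) ^ (Nc n - 1)
            = (w x) ^ 2 * (v x) ^ (-(Nc n) - 1)) →
        v = u) := by
  have hn3 : (3 : ℝ) ≤ n := by exact_mod_cast hn
  have hn2 : (0 : ℝ) < n - 2 := by linarith
  have hc : (0 : ℝ) < 4 * ((n : ℝ) - 1) / ((n : ℝ) - 2) := by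
    have : (0 : ℝ) < n - 1 := by linarith
    positivity
  have hd : (0 : ℝ) ≤ ((n : ℝ) - 1) / n := div_nonneg (by linarith) (by linarith)
  have hd1 : ((n : ℝ) - 1) / n ≤ 1 := (div_le_one (by linarith)).2 (by linarith)
  have hN : 2 ≤ Nc n := by
    rw [Nc, le_div_iff₀ hn2]
    linarith
  obtain ⟨u, hu0, hu, ⟨C', hC', hu1⟩, hul⟩ := exists_lichnerowicz hα.1 hα.2 hc hd hd1
    (e₁ := Nc n - 1) (e₂ := -(Nc n) - 1) (by linarith) (by linarith) hβ hβ' hC hτhol hwhol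
    (sq_le_of_abs_le_rpow hβ hτdec) (sq_le_of_abs_le_rpow hβ hwdec)
  refine ⟨u, hu0, hu, ⟨C', hC', hu1⟩, hul, fun v hv0 hv ⟨C'', _, hv1⟩ hvl => funext fun x => ?_⟩
  exact le_antisymm
    (le_of_lichnerowicz hc hd (by linarith) (by linarith) hβ hβ' hu hv hu0 hu1 hv1 hul hvl x)
    (le_of_lichnerowicz hc hd (by linarith) (by linarith) hβ hβ' hv hu hv0 hv1 hu1 hvl hul x)
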